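/- arXiv:2003.07084 — 3 statements merged into one kernel-verified Lean document; each statement's English description precedes it below -/
import Mathlib

section
/- Let p ∈ (2,∞), x ∈ ℝ^d, and φ ∈ C²(B_R(x)) for some R > 0. Then (1/(C_{d,p} r^p)) ⨍_{∂B_r} |φ(x+y)−φ(x)|^{p-2}(φ(x+y)−φ(x)) dσ(y) → Δ_p φ(x) as r → 0, where C_{d,p} = (1/2)⨍_{∂B_1}|y₁|^p dσ(y). -/
open Real MeasureTheory Metric Filter

lemma hausdorffMeasure_sphere_lt_top (n : ℕ) :
    μH[(n : ℝ)] (sphere (0 : EuclideanSpace ℝ (Fin (n + 1))) 1) < ⊤ := by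
  let G : Fin (n + 1) → ℝ → (Fin n → ℝ) → EuclideanSpace ℝ (Fin (n + 1)) :=
    fun i s w => WithLp.toLp 2 (i.insertNth (α := fun _ => ℝ) s w)
  let F : Fin (n + 1) → ℝ → (Fin n → ℝ) → EuclideanSpace ℝ (Fin (n + 1)) :=
    fun i s w => ‖G i s w‖⁻¹ • G i s w
  let K : Set (Fin n → ℝ) := closedBall 0 1
  have hG : ∀ i s, ContDiff ℝ 1 (G i s) := by
    intro i s
    rw [contDiff_euclidean]
    intro j
    refine i.succAboveCases ?_ (fun k => ?_) j
    · simpa [G] using contDiff_const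
    · simpa [G] using contDiff_apply ℝ ℝ k
  have hG0 : ∀ i s w, s ≠ 0 → G i s w ≠ 0 := by
    intro i s w hs h
    have := congrArg (fun v : EuclideanSpace ℝ (Fin (n + 1)) => v i) h
    simp [G] at this
    exact hs this
  have hF : ∀ i s, s ≠ 0 → ContDiff ℝ 1 (F i s) := fun i s hs =>
    (((hG i s).norm ℝ (fun w => hG0 i s w hs)).inv
      (fun w => norm_ne_zero_iff.mpr (hG0 i s w hs))).smul (hG i s)
  have hfin : ∀ i s, s ≠ 0 → μH[(n : ℝ)] (F i s '' K) < ⊤ := by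
    intro i s hs
    obtain ⟨C, hC⟩ := (hF i s hs).locallyLipschitz.locallyLipschitzOn (s := K)
      |>.exists_lipschitzOnWith_of_compact (isCompact_closedBall 0 1)
    refine (hC.hausdorffMeasure_image_le n.cast_nonneg).trans_lt ?_
    refine ENNReal.mul_lt_top (ENNReal.rpow_lt_top_of_nonneg n.cast_nonneg ENNReal.coe_ne_top) ?_
    have := hausdorffMeasure_pi_real (ι := Fin n)
    rw [Fintype.card_fin] at this
    rw [this]
    exact (isCompact_closedBall 0 1).measure_lt_top
  have hcover : sphere (0 : EuclideanSpace ℝ (Fin (n + 1))) 1 ⊆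
      ⋃ i, (F i 1 '' K ∪ F i (-1) '' K) := by
    intro y hy
    have hy1 : ‖y‖ = 1 := by simpa using hy
    obtain ⟨i, hi⟩ := Finite.exists_max (fun j => |y j|)
    have hm : 0 < |y i| := by
      by_contra h
      have h0 : y = 0 := by
        ext j
        exact abs_nonpos_iff.mp ((hi j).trans (not_lt.mp h))
      simp [h0] at hy1
    have key : ∀ s, y i = |y i| * s → y ∈ F i s '' K := by
      intro s hs
      refine ⟨fun j => y (i.succAbove j) / |y i|, ?_, ?_⟩
      · rw [mem_closedBall_zero_iff, pi_norm_le_iff_of_nonneg zero_le_one]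
        intro j
        rw [Real.norm_eq_abs, abs_div, abs_abs]
        exact div_le_one_of_le₀ (hi _) (abs_nonneg _)
      · have hGy : G i s (fun j => y (i.succAbove j) / |y i|) = |y i|⁻¹ • y := by
          ext j
          refine i.succAboveCases ?_ (fun k => ?_) j
          · simp only [G, Fin.insertNth_apply_same, PiLp.smul_apply, smul_eq_mul]
            rw [eq_comm, inv_mul_eq_iff_eq_mul₀ hm.ne']
            exact hs
          · simp [G, div_eq_inv_mul]
        simp only [F, hGy, norm_smul, hy1, mul_one, norm_inv, Real.norm_eq_abs, abs_abs, inv_inv]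
        rw [smul_smul, mul_inv_cancel₀ hm.ne', one_smul]
    rw [Set.mem_iUnion]
    refine ⟨i, ?_⟩
    rcases abs_choice (y i) with h | h
    · exact Or.inl (key 1 (by linarith))
    · exact Or.inr (key (-1) (by linarith))
  refine (measure_mono hcover).trans_lt ((measure_iUnion_le _).trans_lt ?_)
  rw [tsum_fintype]
  refine ENNReal.sum_lt_top.mpr fun i _ => (measure_union_le _ _).trans_lt ?_
  exact ENNReal.add_lt_top.mpr ⟨hfin i 1 one_ne_zero, hfin i (-1) (by norm_num)⟩

lemma hausdorffMeasure_sphere_pos (n : ℕ) :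
    0 < μH[(n : ℝ)] (sphere (0 : EuclideanSpace ℝ (Fin (n + 1))) 1) := by
  let proj : EuclideanSpace ℝ (Fin (n + 1)) → (Fin n → ℝ) := fun y j => y j.succ
  have hproj : LipschitzWith 1 proj := by
    refine LipschitzWith.of_dist_le_mul fun y z => ?_
    rw [NNReal.coe_one, one_mul, dist_pi_le_iff dist_nonneg]
    intro j
    rw [dist_eq_norm, dist_eq_norm]
    exact PiLp.norm_apply_le (y - z) j.succ
  let V : Set (Fin n → ℝ) := {w | ∑ j, w j ^ 2 < 1}
  have hV : IsOpen V := isOpen_lt (by fun_prop) continuous_const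
  have hVproj : V ⊆ proj '' sphere 0 1 := by
    intro w hw
    have hw' : ∑ j, w j ^ 2 < 1 := hw
    refine ⟨WithLp.toLp 2 (Fin.cons (√(1 - ∑ j, w j ^ 2)) w), ?_, ?_⟩
    · rw [mem_sphere_zero_iff_norm, EuclideanSpace.norm_eq, Fin.sum_univ_succ]
      simp [Real.sq_sqrt (sub_nonneg.mpr hw'.le)]
    · ext j
      simp [proj]
  have h := hausdorffMeasure_pi_real (ι := Fin n)
  rw [Fintype.card_fin] at h
  calc (0 : ENNReal) < volume V := hV.measure_pos _ ⟨0, by simp [V]⟩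
    _ = μH[(n : ℝ)] V := by rw [h]
    _ ≤ μH[(n : ℝ)] (proj '' sphere 0 1) := measure_mono hVproj
    _ ≤ _ := by
      simpa using hproj.hausdorffMeasure_image_le n.cast_nonneg (sphere 0 1)

section
open scoped Topology InnerProductSpace

lemma hasDerivAt_abs_rpow_mul_self {q : ℝ} (hq : 0 < q) (s : ℝ) :
    HasDerivAt (fun t : ℝ => |t| ^ q * t) ((q + 1) * |s| ^ q) s := by
  rcases lt_trichotomy s 0 with hs | rfl | hs
  · have h := ((hasDerivAt_neg s).rpow_const (p := q) (Or.inl (by simpa using hs.ne))).mul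
      (hasDerivAt_id s)
    have h' : HasDerivAt (fun t : ℝ => |t| ^ q * t) _ s := h.congr_of_eventuallyEq <| by
      filter_upwards [Iio_mem_nhds hs] with t ht
      simp [abs_of_neg (show t < 0 from ht)]
    convert h' using 1
    rw [abs_of_neg hs, Real.rpow_sub_one (neg_ne_zero.mpr hs.ne)]
    have := hs.ne
    simp only [id]
    field_simp
  · rw [hasDerivAt_iff_tendsto_slope]
    have h : Tendsto (fun t : ℝ => |t| ^ q) (𝓝[≠] 0) (𝓝 (|0| ^ q)) :=
      ((continuous_abs.rpow_const fun _ => Or.inr hq.le).tendsto 0).mono_left nhdsWithin_le_nhds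
    have e : (q + 1) * |(0 : ℝ)| ^ q = |0| ^ q := by simp [Real.zero_rpow hq.ne']
    rw [e]
    refine h.congr' ?_
    filter_upwards [self_mem_nhdsWithin] with t ht
    have ht' : t ≠ 0 := ht
    simp [slope_def_field, ht']
  · have h := ((hasDerivAt_id s).rpow_const (p := q) (Or.inl hs.ne')).mul (hasDerivAt_id s)
    have h' : HasDerivAt (fun t : ℝ => |t| ^ q * t) _ s := h.congr_of_eventuallyEq <| by
      filter_upwards [Ioi_mem_nhds hs] with t ht
      simp [abs_of_pos (show 0 < t from ht)]
    convert h' using 1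
    rw [abs_of_pos hs, Real.rpow_sub_one (show id s ≠ 0 from hs.ne')]
    have := hs.ne'
    simp only [id]
    field_simp

lemma hasDerivAt_norm_add_smul_rpow {E : Type*} [NormedAddCommGroup E]
    [InnerProductSpace ℝ E] {v : E} (hv : v ≠ 0) (w : E) (q : ℝ) :
    HasDerivAt (fun t : ℝ => ‖v + t • w‖ ^ q) (q * ‖v‖ ^ (q - 2) * ⟪v, w⟫_ℝ) 0 := by
  have hlin : HasDerivAt (fun t : ℝ => v + t • w) w 0 := by
    simpa using ((hasDerivAt_id (0 : ℝ)).smul_const w).const_add v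
  have h := hlin.norm_sq.rpow_const (p := q / 2) (Or.inl (by simpa using hv))
  have e : ∀ (u : E) (a : ℝ), (‖u‖ ^ 2) ^ (a / 2) = ‖u‖ ^ a := fun u a => by
    rw [← Real.rpow_natCast, ← Real.rpow_mul (norm_nonneg u)]
    congr 1
    push_cast
    ring
  have e' : q / 2 - 1 = (q - 2) / 2 := by ring
  simp only [e', e, zero_smul, add_zero] at h
  convert h using 1
  ring

/-- A probability measure on the unit sphere which is invariant under linear isometries. -/
structure IsUniformOnUnitSphere {E : Type*} [NormedAddCommGroup E] [InnerProductSpace ℝ E]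
    [MeasurableSpace E] (P : Measure E) : Prop where
  isProbabilityMeasure : IsProbabilityMeasure P
  ae_norm_eq_one : ∀ᵐ y ∂P, ‖y‖ = 1
  measurePreserving : ∀ U : E ≃ₗᵢ[ℝ] E, MeasurePreserving U P P

namespace IsUniformOnUnitSphere

variable {E : Type*} [NormedAddCommGroup E] [InnerProductSpace ℝ E]
  [MeasurableSpace E] [BorelSpace E] {P : Measure E}

lemma integral_comp (hP : IsUniformOnUnitSphere P) (U : E ≃ₗᵢ[ℝ] E) (f : E → ℝ) :
    ∫ y, f (U y) ∂P = ∫ y, f y ∂P :=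
  (hP.measurePreserving U).integral_comp U.toHomeomorph.measurableEmbedding f

lemma integral_eq_zero_of_odd (hP : IsUniformOnUnitSphere P) {f : E → ℝ}
    (hf : ∀ y, f (-y) = -f y) : ∫ y, f y ∂P = 0 := by
  have h := hP.integral_comp (LinearIsometryEquiv.neg ℝ) f
  simp only [LinearIsometryEquiv.coe_neg, hf, integral_neg] at h
  linarith

lemma integral_abs_inner_rpow (hP : IsUniformOnUnitSphere P) {p : ℝ} {e : E} (he : ‖e‖ = 1)
    (v : E) : ∫ y, |⟪v, y⟫_ℝ| ^ p ∂P = (∫ y, |⟪e, y⟫_ℝ| ^ p ∂P) * ‖v‖ ^ p := by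
  have hnorm : ‖‖v‖ • e‖ = ‖v‖ := by simp [norm_smul, he]
  rw [← hP.integral_comp (Submodule.reflection (ℝ ∙ (‖v‖ • e - v))ᗮ) (fun y => |⟪v, y⟫_ℝ| ^ p),
    ← integral_mul_const]
  congr 1 with y
  nth_rw 1 [← Submodule.reflection_sub hnorm]
  rw [LinearIsometryEquiv.inner_map_map, real_inner_smul_left, abs_mul, abs_norm,
    Real.mul_rpow (norm_nonneg v) (abs_nonneg _), mul_comm]

lemma aestronglyMeasurable_of_continuousOn (hP : IsUniformOnUnitSphere P) {f : E → ℝ}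
    (hf : ContinuousOn f (sphere 0 1)) : AEStronglyMeasurable f P := by
  have hS : P.restrict (sphere 0 1) = P :=
    Measure.restrict_eq_self_of_ae_mem (hP.ae_norm_eq_one.mono fun y hy => by simpa using hy)
  rw [← hS]
  exact hf.aestronglyMeasurable isClosed_sphere.measurableSet

variable [FiniteDimensional ℝ E]

lemma integrable_of_continuousOn (hP : IsUniformOnUnitSphere P) {f : E → ℝ}
    (hf : ContinuousOn f (sphere 0 1)) : Integrable f P := by
  have := hP.isProbabilityMeasure
  obtain ⟨C, hC⟩ := (isCompact_sphere (0 : E) 1).exists_bound_of_continuousOn hf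
  refine Integrable.of_bound (hP.aestronglyMeasurable_of_continuousOn hf) C ?_
  filter_upwards [hP.ae_norm_eq_one] with y hy
  exact hC y (by simpa using hy)

lemma integrable (hP : IsUniformOnUnitSphere P) {f : E → ℝ} (hf : Continuous f) :
    Integrable f P :=
  hP.integrable_of_continuousOn hf.continuousOn

/-- Differentiation under the integral sign for ridge functions. -/
lemma hasDerivAt_integral_ridge (hP : IsUniformOnUnitSphere P) {H H' : ℝ → ℝ} {k : E → ℝ}
    (hH : ∀ s, HasDerivAt H (H' s) s) (hH' : Continuous H') (hk : Continuous k) (v w : E) :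
    HasDerivAt (fun t : ℝ => ∫ y, H ⟪v + t • w, y⟫_ℝ * k y ∂P)
      (∫ y, H' ⟪v, y⟫_ℝ * ⟪w, y⟫_ℝ * k y ∂P) 0 := by
  have := hP.isProbabilityMeasure
  have hHc : Continuous H := continuous_iff_continuousAt.mpr fun s => (hH s).continuousAt
  have hc : Continuous fun z : ℝ × E => H' ⟪v + z.1 • w, z.2⟫_ℝ * ⟪w, z.2⟫_ℝ * k z.2 := by
    fun_prop
  obtain ⟨C, hC⟩ := ((isCompact_closedBall (0 : ℝ) 1).prod (isCompact_sphere (0 : E) 1))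
    |>.exists_bound_of_continuousOn hc.continuousOn
  have h := (hasDerivAt_integral_of_dominated_loc_of_deriv_le (μ := P) (x₀ := (0 : ℝ))
    (F := fun t y => H ⟪v + t • w, y⟫_ℝ * k y)
    (F' := fun t y => H' ⟪v + t • w, y⟫_ℝ * ⟪w, y⟫_ℝ * k y) (bound := fun _ => C)
    (closedBall_mem_nhds (0 : ℝ) one_pos)
    (Eventually.of_forall fun t => Continuous.aestronglyMeasurable (by fun_prop))
    (hP.integrable (by fun_prop)) (Continuous.aestronglyMeasurable (by fun_prop)) ?_
    (integrable_const C) ?_).2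
  · simpa using h
  · filter_upwards [hP.ae_norm_eq_one] with y hy t ht
    exact hC (t, y) ⟨ht, by simpa using hy⟩
  · refine Eventually.of_forall fun y t _ => ?_
    have hin : HasDerivAt (fun t : ℝ => ⟪v + t • w, y⟫_ℝ) ⟪w, y⟫_ℝ t := by
      simp only [inner_add_left, real_inner_smul_left]
      simpa using ((hasDerivAt_id t).mul_const ⟪w, y⟫_ℝ).const_add ⟪v, y⟫_ℝ
    exact ((hH _).comp t hin).mul_const (k y)

lemma integral_abs_inner_rpow_mul_inner (hP : IsUniformOnUnitSphere P) {p : ℝ} (hp : 2 < p)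
    {e : E} (he : ‖e‖ = 1) {v : E} (hv : v ≠ 0) (w : E) :
    ∫ y, |⟪v, y⟫_ℝ| ^ (p - 2) * ⟪v, y⟫_ℝ * ⟪w, y⟫_ℝ ∂P =
      (∫ y, |⟪e, y⟫_ℝ| ^ p ∂P) * (‖v‖ ^ (p - 2) * ⟪v, w⟫_ℝ) := by
  have h₁ := hP.hasDerivAt_integral_ridge (H := fun s => |s| ^ p)
    (H' := fun s => p * |s| ^ (p - 2) * s) (k := fun _ => 1)
    (fun s => hasDerivAt_abs_rpow s (by linarith))
    ((continuous_const.mul (continuous_abs.rpow_const fun _ => Or.inr (by linarith))).mul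
      continuous_id) continuous_const v w
  have h₂ := (hasDerivAt_norm_add_smul_rpow hv w p).const_mul (∫ y, |⟪e, y⟫_ℝ| ^ p ∂P)
  simp only [mul_one, fun t : ℝ => hP.integral_abs_inner_rpow (p := p) he (v + t • w)] at h₁
  have h₃ := h₁.unique h₂
  simp only [mul_assoc, integral_const_mul] at h₃
  have hp0 : p ≠ 0 := by linarith
  apply mul_left_cancel₀ hp0
  simp only [mul_assoc]
  linarith

lemma integral_abs_inner_rpow_mul_inner_mul_inner (hP : IsUniformOnUnitSphere P) {p : ℝ}
    (hp : 2 < p) {e : E} (he : ‖e‖ = 1) {v : E} (hv : v ≠ 0) (w w' : E) :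
    (p - 1) * ∫ y, |⟪v, y⟫_ℝ| ^ (p - 2) * (⟪w, y⟫_ℝ * ⟪w', y⟫_ℝ) ∂P =
      (∫ y, |⟪e, y⟫_ℝ| ^ p ∂P) * (‖v‖ ^ (p - 2) * ⟪w, w'⟫_ℝ +
        (p - 2) * ‖v‖ ^ (p - 4) * (⟪v, w⟫_ℝ * ⟪v, w'⟫_ℝ)) := by
  have h₁ := hP.hasDerivAt_integral_ridge (H := fun s => |s| ^ (p - 2) * s)
    (H' := fun s => (p - 2 + 1) * |s| ^ (p - 2)) (k := fun y => ⟪w', y⟫_ℝ)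
    (fun s => hasDerivAt_abs_rpow_mul_self (by linarith) s)
    (continuous_const.mul (continuous_abs.rpow_const fun _ => Or.inr (by linarith)))
    (by fun_prop) v w
  have hin : HasDerivAt (fun t : ℝ => ⟪v + t • w, w'⟫_ℝ) ⟪w, w'⟫_ℝ 0 := by
    simp only [inner_add_left, real_inner_smul_left]
    simpa using ((hasDerivAt_id (0 : ℝ)).mul_const ⟪w, w'⟫_ℝ).const_add ⟪v, w'⟫_ℝ
  have h₂ := ((hasDerivAt_norm_add_smul_rpow hv w (p - 2)).mul hin).const_mul
    (∫ y, |⟪e, y⟫_ℝ| ^ p ∂P)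
  have h₄ : ∀ᶠ t : ℝ in 𝓝 0, v + t • w ≠ 0 := by
    have : ContinuousAt (fun t : ℝ => v + t • w) 0 := by fun_prop
    exact this.eventually_ne (by simpa using hv)
  have h₃ := h₁.unique (h₂.congr_of_eventuallyEq (h₄.mono fun t ht =>
    hP.integral_abs_inner_rpow_mul_inner hp he ht w'))
  rw [show p - 2 - 2 = p - 4 by ring] at h₃
  simp only [mul_assoc, integral_const_mul, zero_smul, add_zero] at h₃ ⊢
  linarith

lemma integral_abs_inner_rpow_mul_bilin (hP : IsUniformOnUnitSphere P) {p : ℝ}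
    (hp : 2 < p) {e : E} (he : ‖e‖ = 1) (v : E) (A : E →L[ℝ] E →L[ℝ] ℝ) {ι : Type*} [Fintype ι]
    (b : OrthonormalBasis ι ℝ E) :
    (p - 1) * ∫ y, |⟪v, y⟫_ℝ| ^ (p - 2) * A y y ∂P =
      (∫ y, |⟪e, y⟫_ℝ| ^ p ∂P) * (‖v‖ ^ (p - 2) * ∑ i, A (b i) (b i) +
        (p - 2) * ‖v‖ ^ (p - 4) * A v v) := by
  classical
  have hq : p - 2 ≠ 0 := by linarith
  rcases eq_or_ne v 0 with rfl | hv
  · simp [Real.zero_rpow hq]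
  have hA : ∀ y, A y y = ∑ i, ∑ j, A (b i) (b j) * (⟪b i, y⟫_ℝ * ⟪b j, y⟫_ℝ) := by
    intro y
    nth_rw 1 2 [← b.sum_repr' y]
    simp only [map_sum, map_smul, sum_apply, smul_apply,
      smul_eq_mul, Finset.mul_sum]
    rw [Finset.sum_comm]
    exact Finset.sum_congr rfl fun i _ => Finset.sum_congr rfl fun j _ => by ring
  have habs : Continuous fun y => |⟪v, y⟫_ℝ| ^ (p - 2) :=
    Continuous.rpow_const (by fun_prop) fun _ => Or.inr (by linarith)
  have hexpand : ∫ y, |⟪v, y⟫_ℝ| ^ (p - 2) * A y y ∂P = ∑ i, ∑ j, A (b i) (b j) *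
      ∫ y, |⟪v, y⟫_ℝ| ^ (p - 2) * (⟪b i, y⟫_ℝ * ⟪b j, y⟫_ℝ) ∂P := by
    simp only [← integral_const_mul]
    have hi : ∀ i j, Integrable (fun y => A (b i) (b j) *
        (|⟪v, y⟫_ℝ| ^ (p - 2) * (⟪b i, y⟫_ℝ * ⟪b j, y⟫_ℝ))) P := fun i j =>
      hP.integrable (by fun_prop)
    simp only [← integral_finsetSum _ fun j _ => hi _ j]
    rw [← integral_finsetSum _ fun i _ => integrable_finsetSum _ fun j _ => hi i j]
    congr 1 with y
    rw [hA]
    simp only [Finset.mul_sum]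
    exact Finset.sum_congr rfl fun i _ => Finset.sum_congr rfl fun j _ => by ring
  have hdiag : ∑ i, A (b i) (b i) = ∑ i, ∑ j, A (b i) (b j) * ⟪b i, b j⟫_ℝ := by
    simp [b.inner_eq_ite]
  rw [hexpand, hdiag, hA v, Finset.mul_sum]
  simp only [Finset.mul_sum, ← Finset.sum_add_distrib]
  refine Finset.sum_congr rfl fun i _ => Finset.sum_congr rfl fun j _ => ?_
  rw [mul_left_comm, hP.integral_abs_inner_rpow_mul_inner_mul_inner hp he hv,
    real_inner_comm v (b i), real_inner_comm v (b j)]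
  ring

lemma integral_abs_inner_rpow_pos (hP : IsUniformOnUnitSphere P) {p : ℝ} (hp : 0 < p) {e : E}
    (he : ‖e‖ = 1) : 0 < ∫ y, |⟪e, y⟫_ℝ| ^ p ∂P := by
  have := hP.isProbabilityMeasure
  refine (integral_nonneg fun y => by positivity).lt_of_ne' fun h0 => ?_
  let b := stdOrthonormalBasis ℝ E
  have hae : ∀ i, ∀ᵐ y ∂P, ⟪b i, y⟫_ℝ = 0 := by
    intro i
    have hi := hP.integral_abs_inner_rpow (p := p) he (b i)
    have hc : Continuous fun y => |⟪b i, y⟫_ℝ| ^ p :=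
      Continuous.rpow_const (by fun_prop) fun _ => Or.inr hp.le
    rw [h0, zero_mul, integral_eq_zero_iff_of_nonneg (fun y => by positivity)
      (hP.integrable hc)] at hi
    filter_upwards [hi] with y hy
    simpa using (Real.rpow_eq_zero (abs_nonneg _) hp.ne').mp hy
  obtain ⟨y, hy, hy1⟩ := ((eventually_all.mpr hae).and hP.ae_norm_eq_one).exists
  have : y = 0 := by
    rw [← b.sum_repr' y]
    simp [hy]
  simp [this] at hy1

end IsUniformOnUnitSphere

/-- Second order Taylor expansion with Peano remainder. -/
lemma ContDiffAt.isLittleO_taylor_two {E : Type*} [NormedAddCommGroup E] [NormedSpace ℝ E]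
    {φ : E → ℝ} {x : E} (hφ : ContDiffAt ℝ 2 φ x) :
    (fun h => φ (x + h) - φ x - fderiv ℝ φ x h - (1 / 2) * fderiv ℝ (fderiv ℝ φ) x h h)
      =o[𝓝 0] fun h => ‖h‖ ^ 2 := by
  set A := fderiv ℝ (fderiv ℝ φ) x with hAdef
  have hsymm : ∀ v w, A v w = A w v := hφ.isSymmSndFDerivAt (by simp)
  have hA : HasFDerivAt (fderiv ℝ φ) A x :=
    ((hφ.fderiv_right (m := 1) (by norm_num)).differentiableAt one_ne_zero).hasFDerivAt
  have hdiff : ∀ᶠ y in 𝓝 x, DifferentiableAt ℝ φ y :=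
    (hφ.eventually (by simp)).mono fun y hy => hy.differentiableAt two_ne_zero
  have htrans : Tendsto (fun h : E => x + h) (𝓝 0) (𝓝 x) := by
    simpa using (continuous_const_add x).tendsto (0 : E)
  rw [Asymptotics.isLittleO_iff]
  intro ε hε
  have h₁ := (hasFDerivAt_iff_isLittleO_nhds_zero.mp hA).bound hε
  obtain ⟨δ, hδ, hball⟩ := Metric.eventually_nhds_iff_ball.mp (h₁.and (htrans.eventually hdiff))
  filter_upwards [ball_mem_nhds (0 : E) hδ] with h hh
  have hder : ∀ u ∈ closedBall (0 : E) ‖h‖, HasFDerivWithinAt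
      (fun h => φ (x + h) - φ x - fderiv ℝ φ x h - (1 / 2) * A h h)
      (fderiv ℝ φ (x + u) - fderiv ℝ φ x - A u) (closedBall 0 ‖h‖) u := by
    intro u hu
    have hu' : u ∈ ball (0 : E) δ := by
      rw [mem_ball_zero_iff] at hh ⊢
      exact (mem_closedBall_zero_iff.mp hu).trans_lt hh
    have h₂ : HasFDerivAt (fun h => φ (x + h)) (fderiv ℝ φ (x + u)) u :=
      (hasFDerivAt_comp_add_left x).mpr (hball u hu').2.hasFDerivAt
    have h₃ := (A.hasFDerivAt (x := u)).clm_apply (hasFDerivAt_id u)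
    refine (((h₂.sub_const (φ x)).sub (fderiv ℝ φ x).hasFDerivAt).sub
      (h₃.const_mul (1 / 2))).hasFDerivWithinAt.congr_fderiv ?_
    ext w
    simp [hsymm w u]
    ring
  have hbound : ∀ u ∈ closedBall (0 : E) ‖h‖,
      ‖fderiv ℝ φ (x + u) - fderiv ℝ φ x - A u‖ ≤ ε * ‖h‖ := by
    intro u hu
    rw [mem_closedBall_zero_iff] at hu
    have hu' : u ∈ ball (0 : E) δ := by
      rw [mem_ball_zero_iff] at hh ⊢
      exact hu.trans_lt hh
    exact (hball u hu').1.trans (by gcongr)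
  have := (convex_closedBall (0 : E) ‖h‖).norm_image_sub_le_of_norm_hasFDerivWithin_le hder hbound
    (mem_closedBall_self (norm_nonneg h)) (mem_closedBall_zero_iff.mpr le_rfl)
  simpa [pow_two, mul_assoc] using this
end

section
open scoped Topology InnerProductSpace Pointwise

lemma abs_abs_rpow_mul_self_sub_le {q : ℝ} (hq : 0 < q) {B a b : ℝ} (ha : |a| ≤ B)
    (hb : |b| ≤ B) : |(|a| ^ q * a) - |b| ^ q * b| ≤ (q + 1) * B ^ q * |a - b| := by
  refine (convex_closedBall (0 : ℝ) B).norm_image_sub_le_of_norm_hasDerivWithin_le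
    (f := fun t => |t| ^ q * t) (fun s _ => (hasDerivAt_abs_rpow_mul_self hq s).hasDerivWithinAt)
    (fun s hs => ?_) (by simpa using hb) (by simpa using ha)
  have hs' : |s| ≤ B := by simpa using hs
  rw [Real.norm_eq_abs, abs_of_nonneg (by positivity)]
  gcongr

lemma IsUniformOnUnitSphere.tendsto_integral_rpow {E : Type*} [NormedAddCommGroup E]
    [InnerProductSpace ℝ E] [FiniteDimensional ℝ E] [MeasurableSpace E] [BorelSpace E]
    {P : Measure E} (hP : IsUniformOnUnitSphere P) {p : ℝ} (hp : 2 < p) {φ : E → ℝ} {x : E}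
    (hφ : ContDiffAt ℝ 2 φ x) :
    Tendsto (fun r : ℝ => (r ^ p)⁻¹ *
        ∫ z, |φ (x + r • z) - φ x| ^ (p - 2) * (φ (x + r • z) - φ x) ∂P) (𝓝[>] 0)
      (𝓝 ((p - 1) / 2 * ∫ z, |fderiv ℝ φ x z| ^ (p - 2) * fderiv ℝ (fderiv ℝ φ) x z z ∂P)) := by
  have := hP.isProbabilityMeasure
  have hq : 0 < p - 2 := by linarith
  set L := fderiv ℝ φ x with hL
  set A := fderiv ℝ (fderiv ℝ φ) x with hA
  let J : ℝ → ℝ := fun t => |t| ^ (p - 2) * t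
  have hJ : ∀ s, HasDerivAt J ((p - 2 + 1) * |s| ^ (p - 2)) s :=
    hasDerivAt_abs_rpow_mul_self hq
  have hJc : Continuous J := continuous_iff_continuousAt.mpr fun s => (hJ s).continuousAt
  let D : ℝ → E → ℝ := fun r z => (φ (x + r • z) - φ x) / r
  have hT := hφ.isLittleO_taylor_two
  rw [← hL, ← hA] at hT
  let T : E → ℝ := fun h => φ (x + h) - φ x - L h - (1 / 2) * A h h
  have hD : ∀ r z, r ≠ 0 → D r z = L z + r * (A z z / 2) + T (r • z) / r := by
    intro r z hr
    simp only [D, T, map_smul, smul_apply, smul_eq_mul]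
    field_simp
    ring
  have hcont : ∀ᶠ y in 𝓝 x, ContinuousAt φ y :=
    (hφ.eventually (by simp)).mono fun y hy => hy.continuousAt
  have htrans : Tendsto (fun h : E => x + h) (𝓝 0) (𝓝 x) := by
    simpa using (continuous_const_add x).tendsto (0 : E)
  obtain ⟨δ, hδ, hball⟩ := Metric.eventually_nhds_iff_ball.mp
    ((hT.bound one_pos).and (htrans.eventually hcont))
  have hmem : ∀ r ∈ Set.Ioo (0 : ℝ) δ, ∀ z : E, ‖z‖ = 1 → r • z ∈ ball (0 : E) δ := by
    intro r hr z hz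
    rw [mem_ball_zero_iff, norm_smul, hz, mul_one, Real.norm_eq_abs, abs_of_pos hr.1]
    exact hr.2
  have hDcont : ∀ r ∈ Set.Ioo (0 : ℝ) δ, ContinuousOn (D r) (sphere 0 1) := by
    intro r hr z hz
    have h₁ : ContinuousAt φ (x + r • z) := (hball _ (hmem r hr z (by simpa using hz))).2
    have h₂ : ContinuousAt (fun z => φ (x + r • z)) z :=
      ContinuousAt.comp' (f := fun z => x + r • z) h₁ (by fun_prop)
    exact ((h₂.sub continuousAt_const).div_const r).continuousWithinAt
  have hJL : ∫ z, J (L z) ∂P = 0 := hP.integral_eq_zero_of_odd fun y => by simp [J]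
  have hIoo : Set.Ioo (0 : ℝ) δ ∈ 𝓝[>] (0 : ℝ) := Ioo_mem_nhdsGT hδ
  have heq : ∀ r ∈ Set.Ioo (0 : ℝ) δ, ∫ z, (J (D r z) - J (L z)) / r ∂P =
      (r ^ p)⁻¹ * ∫ z, |φ (x + r • z) - φ x| ^ (p - 2) * (φ (x + r • z) - φ x) ∂P := by
    intro r hr
    have hr0 := hr.1
    have h₁ : Integrable (fun z => J (D r z)) P :=
      hP.integrable_of_continuousOn (hJc.comp_continuousOn (hDcont r hr))
    have h₂ : Integrable (fun z => J (L z)) P := hP.integrable (by fun_prop)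
    rw [integral_div, integral_sub h₁ h₂, hJL, sub_zero, ← integral_div, ← integral_const_mul]
    congr 1 with z
    simp only [J, D]
    rw [abs_div, abs_of_pos hr0, Real.div_rpow (abs_nonneg _) hr0.le, Real.rpow_sub hr0,
      Real.rpow_two]
    have : r ^ p ≠ 0 := (Real.rpow_pos_of_pos hr0 p).ne'
    field_simp
  refine Tendsto.congr' (eventually_of_mem hIoo heq) ?_
  rw [← integral_const_mul]
  let M : ℝ := ‖A‖ / 2 + 1
  have hM : 0 ≤ M := by positivity
  refine tendsto_integral_filter_of_dominated_convergence
    (fun _ => (p - 2 + 1) * (‖L‖ + δ * M) ^ (p - 2) * M) ?_ ?_ (integrable_const _) ?_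
  · filter_upwards [hIoo] with r hr
    exact hP.aestronglyMeasurable_of_continuousOn
      (((hJc.comp_continuousOn (hDcont r hr)).sub (by fun_prop)).div_const r)
  · filter_upwards [hIoo] with r hr
    filter_upwards [hP.ae_norm_eq_one] with z hz
    have hr0 := hr.1
    have hLz : |L z| ≤ ‖L‖ := by simpa [hz] using L.le_opNorm z
    have hAz : |A z z| ≤ ‖A‖ := by simpa [hz] using A.le_opNorm₂ z z
    have hTz : |T (r • z)| ≤ r ^ 2 := by
      have : |T (r • z)| ≤ 1 * ‖‖r • z‖ ^ 2‖ := (hball _ (hmem r hr z hz)).1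
      simpa only [norm_pow, norm_norm, norm_smul, hz, mul_one, one_mul, Real.norm_eq_abs,
        sq_abs] using this
    have hdiff : |D r z - L z| ≤ r * M := by
      have e : D r z - L z = r * (A z z / 2) + T (r • z) / r := by
        rw [hD r z hr0.ne']
        ring
      have h₁ : |T (r • z) / r| ≤ r := by
        rw [abs_div, abs_of_pos hr0, div_le_iff₀ hr0]
        linarith
      have h₂ : |r * (A z z / 2)| ≤ r * (‖A‖ / 2) := by
        rw [abs_mul, abs_of_pos hr0, abs_div, abs_two]
        gcongr
      rw [e]
      refine (abs_add_le _ _).trans ?_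
      simp only [M]
      linarith
    have hrM : r * M ≤ δ * M := mul_le_mul_of_nonneg_right hr.2.le hM
    have hDz : |D r z| ≤ ‖L‖ + δ * M := by
      have := abs_sub_abs_le_abs_sub (D r z) (L z)
      linarith
    have := abs_abs_rpow_mul_self_sub_le hq hDz (hLz.trans (by
      have : 0 ≤ δ * M := by positivity
      linarith))
    rw [Real.norm_eq_abs, abs_div, abs_of_pos hr0, div_le_iff₀ hr0]
    refine this.trans ?_
    rw [mul_assoc _ M r, mul_comm M r]
    gcongr
  · filter_upwards [hP.ae_norm_eq_one] with z hz
    let γ : ℝ → ℝ := fun r => L z + r * (A z z / 2) + T (r • z) / r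
    have hTr : Tendsto (fun r : ℝ => T (r • z) / r ^ 2) (𝓝[>] 0) (𝓝 0) := by
      have hs : Tendsto (fun r : ℝ => r • z) (𝓝[>] 0) (𝓝 0) := by
        have : Continuous fun r : ℝ => r • z := by fun_prop
        simpa using (this.tendsto 0).mono_left nhdsWithin_le_nhds
      have : Tendsto (fun r : ℝ => T (r • z) / ‖r • z‖ ^ 2) (𝓝[>] 0) (𝓝 0) :=
        (hT.comp_tendsto hs).tendsto_div_nhds_zero
      simpa only [norm_smul, hz, mul_one, Real.norm_eq_abs, sq_abs] using this
    have hγ : HasDerivWithinAt γ (A z z / 2) (Set.Ioi 0) 0 := by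
      rw [hasDerivWithinAt_iff_tendsto_slope' (by simp)]
      have := hTr.const_add (A z z / 2)
      rw [add_zero] at this
      refine this.congr' ?_
      filter_upwards [self_mem_nhdsWithin] with r hr
      have hr0 : r ≠ 0 := (show 0 < r from hr).ne'
      simp only [γ, slope_def_field]
      field_simp
      simp
      field_simp
      ring
    have hγ0 : γ 0 = L z := by simp [γ]
    have hcomp := (hJ (γ 0)).comp_hasDerivWithinAt (0 : ℝ) hγ
    rw [hasDerivWithinAt_iff_tendsto_slope' (by simp), hγ0] at hcomp
    have e : (p - 2 + 1) * |L z| ^ (p - 2) * (A z z / 2) =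
        (p - 1) / 2 * (|L z| ^ (p - 2) * A z z) := by ring
    rw [e] at hcomp
    refine hcomp.congr' ?_
    filter_upwards [self_mem_nhdsWithin] with r hr
    have hr0 : r ≠ 0 := (show 0 < r from hr).ne'
    rw [slope_def_field, Function.comp_apply, Function.comp_apply, hγ0, sub_zero, hD r z hr0]

/-- The normalized restriction of the Hausdorff measure of dimension `s` to the unit sphere. -/
noncomputable def unitSphereMeasure (E : Type*) [NormedAddCommGroup E] [MeasurableSpace E]
    [BorelSpace E] (s : ℝ) : Measure E :=
  (μH[s].restrict (sphere (0 : E) 1) Set.univ)⁻¹ • μH[s].restrict (sphere (0 : E) 1)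

lemma isUniformOnUnitSphere_unitSphereMeasure {E : Type*} [NormedAddCommGroup E]
    [InnerProductSpace ℝ E] [MeasurableSpace E] [BorelSpace E] {s : ℝ}
    (h₀ : μH[s] (sphere (0 : E) 1) ≠ 0) (h_top : μH[s] (sphere (0 : E) 1) ≠ ⊤) :
    IsUniformOnUnitSphere (unitSphereMeasure E s) where
  isProbabilityMeasure := ⟨by
    rw [unitSphereMeasure, Measure.smul_apply, Measure.restrict_apply_univ, smul_eq_mul,
      ENNReal.inv_mul_cancel h₀ h_top]⟩
  ae_norm_eq_one := Measure.ae_smul_measure (by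
    filter_upwards [ae_restrict_mem isClosed_sphere.measurableSet] with y hy
    simpa using hy) _
  measurePreserving U := by
    have h := (U.toIsometryEquiv.measurePreserving_hausdorffMeasure s).restrict_preimage
      (isClosed_sphere (x := (0 : E)) (ε := 1)).measurableSet
    have e : U.toIsometryEquiv ⁻¹' sphere (0 : E) 1 = sphere 0 1 := by
      ext y
      simp
    rw [e] at h
    exact h.smul_measure _

lemma setAverage_sphere_hausdorffMeasure {E : Type*} [NormedAddCommGroup E] [NormedSpace ℝ E]
    [MeasurableSpace E] [BorelSpace E] {s : ℝ} (hs : 0 ≤ s) {r : ℝ} (hr : 0 < r) (f : E → ℝ) :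
    ⨍ y in sphere (0 : E) r, f y ∂μH[s] = ∫ z, f (r • z) ∂unitSphereMeasure E s := by
  have hc : ((‖r‖₊ ^ s : NNReal) : ENNReal) ≠ 0 :=
    ENNReal.coe_ne_zero.mpr (NNReal.rpow_pos (nnnorm_pos.mpr hr.ne')).ne'
  have hmap : μH[s].restrict (sphere (0 : E) r) =
      (‖r‖₊ ^ s) • (μH[s].restrict (sphere (0 : E) 1)).map (fun z => r • z) := by
    ext B hB
    have hm : Measurable fun z : E => r • z := measurable_const_smul r
    rw [Measure.smul_apply, Measure.map_apply hm hB, Measure.restrict_apply hB,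
      Measure.restrict_apply (hm hB), ← Measure.hausdorffMeasure_smul₀ hs hr.ne']
    congr 1
    ext y
    rw [Set.mem_smul_set_iff_inv_smul_mem₀ hr.ne']
    simp [smul_inv_smul₀ hr.ne', norm_smul, abs_of_pos hr, inv_mul_eq_one₀ hr.ne', eq_comm]
  have hme : MeasurableEmbedding fun z : E => r • z :=
    (Homeomorph.smulOfNeZero r hr.ne').measurableEmbedding
  rw [average, unitSphereMeasure, ← hme.integral_map, Measure.map_smul, hmap]
  congr 1
  set ν := μH[s].restrict (sphere (0 : E) 1)
  rw [Measure.smul_apply, hme.map_apply, Set.preimage_univ, ENNReal.smul_def, smul_eq_mul,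
    ENNReal.mul_inv (Or.inl hc) (Or.inl ENNReal.coe_ne_top)]
  rw [mul_comm, mul_smul]
  congr 1
  ext B
  simp only [Measure.smul_apply, ENNReal.smul_def, smul_eq_mul, ← mul_assoc,
    ENNReal.inv_mul_cancel hc ENNReal.coe_ne_top, one_mul]
end

theorem stmt_7 (d : ℕ) (hd : 0 < d) (p R : ℝ) (hp : 2 < p) (hR : 0 < R)
    (x : EuclideanSpace ℝ (Fin d)) (φ : EuclideanSpace ℝ (Fin d) → ℝ)
    (hφ : ContDiffOn ℝ 2 φ (ball x R)) :
    Tendsto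
      (fun r : ℝ =>
        (1 / (((1 / 2) * ⨍ y in sphere (0 : EuclideanSpace ℝ (Fin d)) 1,
            |y ⟨0, hd⟩| ^ p ∂μH[(d : ℝ) - 1]) * r ^ p)) *
          ⨍ y in sphere (0 : EuclideanSpace ℝ (Fin d)) r,
            |φ (x + y) - φ x| ^ (p - 2) * (φ (x + y) - φ x) ∂μH[(d : ℝ) - 1])
      (nhdsWithin 0 (Set.Ioi 0))
      (nhds
        (‖gradient φ x‖ ^ (p - 2) *
            (∑ i, iteratedFDeriv ℝ 2 φ x ![EuclideanSpace.single i 1, EuclideanSpace.single i 1]) +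
          (p - 2) * ‖gradient φ x‖ ^ (p - 4) *
            iteratedFDeriv ℝ 2 φ x ![gradient φ x, gradient φ x])) := by
  obtain ⟨n, rfl⟩ : ∃ n, d = n + 1 := ⟨d - 1, by omega⟩
  have hdim : ((n + 1 : ℕ) : ℝ) - 1 = n := by push_cast; ring
  rw [hdim]
  have hP : IsUniformOnUnitSphere (unitSphereMeasure (EuclideanSpace ℝ (Fin (n + 1))) n) :=
    isUniformOnUnitSphere_unitSphereMeasure (hausdorffMeasure_sphere_pos n).ne'
      (hausdorffMeasure_sphere_lt_top n).ne
  set P := unitSphereMeasure (EuclideanSpace ℝ (Fin (n + 1))) n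
  have hφx : ContDiffAt ℝ 2 φ x := hφ.contDiffAt (ball_mem_nhds x hR)
  let e : EuclideanSpace ℝ (Fin (n + 1)) := EuclideanSpace.single ⟨0, hd⟩ 1
  have he : ‖e‖ = 1 := by simp [e]
  have hK := hP.integral_abs_inner_rpow_pos (p := p) (by linarith) he
  have hC : ⨍ y in sphere (0 : EuclideanSpace ℝ (Fin (n + 1))) 1, |y ⟨0, hd⟩| ^ p ∂μH[(n : ℝ)] =
      ∫ y, |inner ℝ e y| ^ p ∂P := by
    rw [setAverage_sphere_hausdorffMeasure n.cast_nonneg one_pos]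
    simp [e, EuclideanSpace.inner_single_left, P]
  have hgrad : ∀ z, fderiv ℝ φ x z = inner ℝ (gradient φ x) z := fun z => by
    rw [← toDual_gradient, InnerProductSpace.toDual_apply_apply]
  have hlim := (hP.tendsto_integral_rpow hp hφx).const_mul (2 / ∫ y, |inner ℝ e y| ^ p ∂P)
  have hmain := hP.integral_abs_inner_rpow_mul_bilin hp he (gradient φ x)
    (fderiv ℝ (fderiv ℝ φ) x) (EuclideanSpace.basisFun (Fin (n + 1)) ℝ)
  simp only [iteratedFDeriv_two_apply, hC]
  refine Tendsto.congr' ?_ (hlim.trans_eq ?_)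
  · filter_upwards [self_mem_nhdsWithin] with r hr
    rw [setAverage_sphere_hausdorffMeasure n.cast_nonneg hr]
    have : r ^ p ≠ 0 := (Real.rpow_pos_of_pos hr p).ne'
    field_simp
    rfl
  · congr 1
    simp only [EuclideanSpace.basisFun_apply] at hmain
    rw [div_mul_eq_mul_div, div_eq_iff hK.ne']
    simp only [hgrad, Matrix.cons_val_zero, Matrix.cons_val_one]
    linarith
end

section
/- Let p ∈ (1,2), x ∈ ℝ^d, and φ ∈ C²(B_R(x)) with ∇φ(x) ≠ 0. Then (1/(C_{d,p} r^p)) ⨍_{∂B_r} |φ(x+y)−φ(x)|^{p-2}(φ(x+y)−φ(x)) dσ(y) → Δ_p φ(x) as r → 0, where C_{d,p} = (1/2)⨍_{∂B_1}|y₁|^p dσ(y). -/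
open Real MeasureTheory Metric Filter

/-- The signed power `J_p(t) = |t|^(p-2) t`. -/
noncomputable def signedPow (p t : ℝ) : ℝ := |t| ^ (p - 2) * t

namespace signedPow

lemma zero (p : ℝ) : signedPow p 0 = 0 := by simp [signedPow]

lemma neg (p t : ℝ) : signedPow p (-t) = -signedPow p t := by simp [signedPow]

lemma mul (p s t : ℝ) : signedPow p (s * t) = signedPow p s * signedPow p t := by
  simp only [signedPow, abs_mul, mul_rpow (abs_nonneg s) (abs_nonneg t)]
  ring

lemma of_nonneg {p t : ℝ} (hp : 1 < p) (ht : 0 ≤ t) : signedPow p t = t ^ (p - 1) := by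
  rcases ht.eq_or_lt with rfl | ht
  · rw [zero, zero_rpow (by linarith)]
  · rw [signedPow, abs_of_pos ht, ← rpow_add_one ht.ne']
    congr 1
    ring

lemma abs_eq {p : ℝ} (hp : 1 < p) (t : ℝ) : |signedPow p t| = |t| ^ (p - 1) := by
  rw [← of_nonneg hp (abs_nonneg t), signedPow, signedPow, abs_mul, abs_abs,
    abs_of_nonneg (rpow_nonneg (abs_nonneg t) _)]

lemma measurable (p : ℝ) : Measurable (signedPow p) := by
  unfold signedPow
  fun_prop

lemma abs_sub_one_le {p : ℝ} (hp1 : 1 < p) (hp2 : p < 2) (u : ℝ) :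
    |signedPow p u - 1| ≤ 2 * |u - 1| := by
  have h1 : ∀ v : ℝ, 1 ≤ v → 1 ≤ v ^ (p - 1) ∧ v ^ (p - 1) ≤ v := fun v hv =>
    ⟨one_le_rpow hv (by linarith), by
      simpa using rpow_le_rpow_of_exponent_le hv (show p - 1 ≤ 1 by linarith)⟩
  have h2 : ∀ v : ℝ, 0 ≤ v → v ≤ 1 → v ≤ v ^ (p - 1) ∧ v ^ (p - 1) ≤ 1 := fun v hv hv' =>
    ⟨by simpa using rpow_le_rpow_of_exponent_ge' hv hv' (by linarith) (show p - 1 ≤ 1 by linarith),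
      rpow_le_one hv hv' (by linarith)⟩
  rcases le_total 0 u with hu | hu
  · rw [of_nonneg hp1 hu]
    rcases le_total 1 u with h | h
    · have := h1 u h
      rw [abs_of_nonneg (by linarith), abs_of_nonneg (by linarith)]
      linarith
    · have := h2 u hu h
      rw [abs_of_nonpos (by linarith), abs_of_nonpos (by linarith)]
      linarith
  · obtain ⟨v, rfl⟩ : ∃ v, u = -v := ⟨-u, by simp⟩
    have hv : 0 ≤ v := by linarith
    have hv0 := rpow_nonneg hv (p - 1)
    rw [neg, of_nonneg hp1 hv, abs_of_nonpos (by linarith), abs_of_nonpos (by linarith)]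
    rcases le_total 1 v with h | h
    · linarith [h1 v h]
    · linarith [h2 v hv h]

lemma abs_sub_le {p : ℝ} (hp1 : 1 < p) (hp2 : p < 2) {a : ℝ} (ha : a ≠ 0) (b : ℝ) :
    |signedPow p b - signedPow p a| ≤ 2 * |a| ^ (p - 2) * |b - a| := by
  have h : signedPow p b - signedPow p a = signedPow p a * (signedPow p (b / a) - 1) := by
    rw [mul_sub, ← mul, mul_div_cancel₀ _ ha, mul_one]
  rw [h, abs_mul, signedPow, abs_mul, abs_of_nonneg (rpow_nonneg (abs_nonneg a) _)]
  calc |a| ^ (p - 2) * |a| * |signedPow p (b / a) - 1|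
      ≤ |a| ^ (p - 2) * |a| * (2 * |b / a - 1|) := by
        gcongr
        exact abs_sub_one_le hp1 hp2 _
    _ = 2 * |a| ^ (p - 2) * |a * (b / a - 1)| := by rw [abs_mul]; ring
    _ = 2 * |a| ^ (p - 2) * |b - a| := by rw [mul_sub, mul_div_cancel₀ _ ha, mul_one]

lemma hasDerivAt {p : ℝ} (hp1 : 1 < p) {a : ℝ} (ha : a ≠ 0) :
    HasDerivAt (signedPow p) ((p - 1) * |a| ^ (p - 2)) a := by
  have hpos : ∀ c : ℝ, 0 < c → HasDerivAt (signedPow p) ((p - 1) * |c| ^ (p - 2)) c := by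
    intro c hc
    have h := Real.hasDerivAt_rpow_const (x := c) (p := p - 1) (Or.inl hc.ne')
    rw [show p - 1 - 1 = p - 2 by ring] at h
    rw [abs_of_pos hc]
    refine h.congr_of_eventuallyEq ?_
    filter_upwards [eventually_gt_nhds hc] with t ht using of_nonneg hp1 ht.le
  rcases ha.lt_or_gt with h | h
  · have h1 := (hpos (-a) (by linarith)).scomp a (hasDerivAt_neg a)
    have h2 := h1.neg
    simp only [abs_neg, smul_eq_mul, neg_mul, one_mul, neg_neg] at h2
    refine h2.congr_of_eventuallyEq (Eventually.of_forall fun t => ?_)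
    simp [neg]
  · exact hpos a h

end signedPow

lemma exists_taylor_two_remainder_le {E : Type*} [NormedAddCommGroup E] [InnerProductSpace ℝ E]
    [CompleteSpace E] {φ : E → ℝ} {x : E} (hφ : ContDiffAt ℝ 2 φ x) {ε : ℝ} (hε : 0 < ε) :
    ∃ δ > 0, ∀ h : E, ‖h‖ < δ →
      |φ (x + h) - φ x - inner ℝ (gradient φ x) h - iteratedFDeriv ℝ 2 φ x ![h, h] / 2|
        ≤ ε * ‖h‖ ^ 2 := by
  have hsym : IsSymmSndFDerivAt ℝ φ x := hφ.isSymmSndFDerivAt (by simp)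
  have hd : DifferentiableAt ℝ (fderiv ℝ φ) x :=
    (hφ.fderiv_right (m := 1) (by norm_num)).differentiableAt (by norm_num)
  have hev : ∀ᶠ y in nhds x, DifferentiableAt ℝ φ y := by
    filter_upwards [hφ.eventually (by simp)] with y hy using hy.differentiableAt (by norm_num)
  have hlo := hd.hasFDerivAt.isLittleO.def hε
  obtain ⟨δ, hδ, hball⟩ := Metric.eventually_nhds_iff_ball.1 (hev.and hlo)
  refine ⟨δ, hδ, fun h hh => ?_⟩
  set A := fderiv ℝ (fderiv ℝ φ) x with hA
  have hderiv : ∀ y ∈ ball x δ, HasFDerivAt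
      (fun y => φ y - fderiv ℝ φ x (y - x) - A (y - x) (y - x) / 2)
      (fderiv ℝ φ y - fderiv ℝ φ x - A (y - x)) y := by
    intro y hy
    have h0 : HasFDerivAt (fun y => y - x) (ContinuousLinearMap.id ℝ E) y :=
      (hasFDerivAt_id y).sub_const x
    have h1 := (hball y hy).1.hasFDerivAt
    have h2 := (fderiv ℝ φ x).hasFDerivAt.comp y h0
    have h3 := ((A.hasFDerivAt.comp y h0).clm_apply h0).mul_const (1 / 2 : ℝ)
    refine (((h1.sub h2).sub h3).congr_of_eventuallyEq
      (Eventually.of_forall fun z => ?_)).congr_fderiv (ContinuousLinearMap.ext fun z => ?_)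
    · simp [div_eq_mul_inv]
    · have := hsym z (y - x)
      rw [← hA] at this
      simp only [map_sub, sub_apply] at this
      simp
      linarith
  have hmem : ∀ t ∈ segment ℝ x (x + h), t ∈ ball x δ ∧ ‖t - x‖ ≤ ‖h‖ := by
    intro t ht
    have : ‖t - x‖ ≤ ‖h‖ := by simpa [dist_eq_norm] using (norm_sub_le_of_mem_segment ht)
    exact ⟨by rw [mem_ball, dist_eq_norm]; linarith, this⟩
  have key := (convex_segment x (x + h)).norm_image_sub_le_of_norm_hasFDerivWithin_le
    (C := ε * ‖h‖) (fun t ht => (hderiv t (hmem t ht).1).hasFDerivWithinAt)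
    (fun t ht => ((hball t (hmem t ht).1).2).trans
      (mul_le_mul_of_nonneg_left (hmem t ht).2 hε.le))
    (left_mem_segment ℝ x (x + h)) (right_mem_segment ℝ x (x + h))
  have hg : inner ℝ (gradient φ x) h = fderiv ℝ φ x h := by
    simp [gradient]
  have h2 : iteratedFDeriv ℝ 2 φ x ![h, h] = A h h := by
    rw [iteratedFDeriv_two_apply]; simp [hA]
  rw [hg, h2]
  simp only [add_sub_cancel_left, sub_self, map_zero, sub_zero, zero_div, norm_eq_abs] at key
  convert key using 1
  · congr 1; ring
  · ring

namespace EuclideanSpace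

variable {n : ℕ}

/-- The `n`-dimensional Hausdorff measure on the unit sphere of `ℝ^(n+1)`. -/
noncomputable def sphereMeasure (n : ℕ) : Measure (EuclideanSpace ℝ (Fin (n + 1))) :=
  (Measure.hausdorffMeasure (n : ℝ)).restrict (sphere 0 1)

/-- The upper hemisphere as a graph over the first `n` free coordinates. -/
noncomputable def hemisphereGraph (n : ℕ) (y : Fin n → ℝ) : EuclideanSpace ℝ (Fin (n + 1)) :=
  WithLp.toLp 2 (Fin.cons (√(1 - ∑ i, y i ^ 2)) y)

lemma hemisphereGraph_mem_sphere {y : Fin n → ℝ} (hy : ∑ i, y i ^ 2 ≤ 1) :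
    hemisphereGraph n y ∈ sphere 0 1 := by
  rw [mem_sphere_zero_iff_norm, EuclideanSpace.norm_eq, Real.sqrt_eq_one, Fin.sum_univ_succ]
  simp [hemisphereGraph, Real.sq_sqrt (sub_nonneg.2 hy)]

lemma hemisphereGraph_tail {x : EuclideanSpace ℝ (Fin (n + 1))} (hx : x ∈ sphere 0 1)
    (h0 : 0 ≤ x 0) : hemisphereGraph n (fun i => x i.succ) = x := by
  rw [mem_sphere_zero_iff_norm, EuclideanSpace.norm_eq, Real.sqrt_eq_one, Fin.sum_univ_succ] at hx
  ext i
  refine Fin.cases ?_ (fun j => ?_) i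
  · simp only [norm_eq_abs, sq_abs] at hx
    simp only [hemisphereGraph, Fin.cons_zero]
    rw [← hx, add_sub_cancel_right, Real.sqrt_sq h0]
  · simp [hemisphereGraph]

lemma contDiffAt_hemisphereGraph : ContDiffAt ℝ 1 (hemisphereGraph n) 0 := by
  rw [contDiffAt_euclidean]
  intro i
  refine Fin.cases ?_ (fun j => ?_) i
  · simp only [hemisphereGraph, Fin.cons_zero]
    refine ContDiffAt.sqrt (by fun_prop) (by simp)
  · simp only [hemisphereGraph, Fin.cons_succ]
    fun_prop

lemma exists_linearIsometryEquiv_apply_eq {E : Type*} [NormedAddCommGroup E]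
    [InnerProductSpace ℝ E] {v w : E} (h : ‖v‖ = ‖w‖) : ∃ L : E ≃ₗᵢ[ℝ] E, L v = w :=
  ⟨(ℝ ∙ (v - w))ᗮ.reflection, Submodule.reflection_sub h⟩

lemma hausdorffMeasure_sphere_lt_top :
    Measure.hausdorffMeasure (n : ℝ) (sphere (0 : EuclideanSpace ℝ (Fin (n + 1))) 1) < ⊤ := by
  refine (isCompact_sphere _ _).measure_lt_top_of_nhdsWithin fun x hx => ?_
  obtain ⟨K, t, ht, hK⟩ := (contDiffAt_hemisphereGraph (n := n)).exists_lipschitzOnWith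
  obtain ⟨ρ, hρ, hball⟩ := Metric.mem_nhds_iff.1 ht
  set e : EuclideanSpace ℝ (Fin (n + 1)) := EuclideanSpace.single 0 1
  obtain ⟨L, hL⟩ := exists_linearIsometryEquiv_apply_eq (v := x) (w := e)
    (by simpa [e] using hx)
  have hfin : Measure.hausdorffMeasure (n : ℝ) (hemisphereGraph n '' ball 0 ρ) < ⊤ := by
    refine ((hK.mono hball).hausdorffMeasure_image_le n.cast_nonneg).trans_lt ?_
    refine ENNReal.mul_lt_top (by simp) ?_
    have : (Measure.hausdorffMeasure (n : ℝ) : Measure (Fin n → ℝ)) = volume := by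
      simpa using hausdorffMeasure_pi_real (ι := Fin n)
    rw [this]
    exact measure_ball_lt_top
  refine ⟨L ⁻¹' (hemisphereGraph n '' ball 0 ρ), ?_, ?_⟩
  · have hcont : ContinuousAt (fun z => fun i : Fin n => L z i.succ) x := by fun_prop
    have hcont0 : ContinuousAt (fun z => L z 0) x := by fun_prop
    have hz : (fun i : Fin n => L x i.succ) = 0 := by
      ext i; simp [hL, e]
    have h1 := hcont.preimage_mem_nhds (t := ball 0 ρ) (by
      simpa only [hz] using ball_mem_nhds (0 : Fin n → ℝ) hρ)
    have h2 := hcont0.eventually (lt_mem_nhds (show (0 : ℝ) < L x 0 by simp [hL, e]))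
    filter_upwards [mem_nhdsWithin_of_mem_nhds h1, mem_nhdsWithin_of_mem_nhds h2,
      self_mem_nhdsWithin] with z hz1 hz2 hz3
    refine ⟨_, hz1, hemisphereGraph_tail (by simpa using hz3) hz2.le⟩
  · have := L.toIsometryEquiv.hausdorffMeasure_preimage (n : ℝ) (hemisphereGraph n '' ball 0 ρ)
    exact this.trans_lt hfin

lemma hausdorffMeasure_sphere_pos :
    0 < Measure.hausdorffMeasure (n : ℝ) (sphere (0 : EuclideanSpace ℝ (Fin (n + 1))) 1) := by
  have hlip : LipschitzWith 1
      (fun (x : EuclideanSpace ℝ (Fin (n + 1))) (i : Fin n) => x i.succ) := by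
    refine LipschitzWith.of_dist_le_mul fun x y => ?_
    rw [NNReal.coe_one, one_mul, dist_pi_le_iff dist_nonneg]
    intro i
    simpa [dist_eq_norm] using PiLp.norm_apply_le (x - y) i.succ
  have h := hlip.hausdorffMeasure_image_le (n.cast_nonneg : (0 : ℝ) ≤ n) (sphere 0 1)
  have hvol : (Measure.hausdorffMeasure (n : ℝ) : Measure (Fin n → ℝ)) = volume := by
    simpa using hausdorffMeasure_pi_real (ι := Fin n)
  simp only [ENNReal.coe_one, ENNReal.one_rpow, one_mul, hvol] at h
  refine lt_of_lt_of_le ?_ h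
  refine Measure.measure_pos_of_mem_nhds (x := 0) _ ?_
  have hcont : Continuous fun y : Fin n → ℝ => ∑ i, y i ^ 2 := by fun_prop
  filter_upwards [hcont.continuousAt.eventually (gt_mem_nhds (show _ < (1 : ℝ) by simp))] with y hy
  exact ⟨hemisphereGraph n y, hemisphereGraph_mem_sphere hy.le, by ext; simp [hemisphereGraph]⟩

instance : IsFiniteMeasure (sphereMeasure n) :=
  ⟨by simpa [sphereMeasure] using hausdorffMeasure_sphere_lt_top⟩

lemma sphereMeasure_univ_ne_zero : sphereMeasure n Set.univ ≠ 0 := by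
  simpa [sphereMeasure] using (hausdorffMeasure_sphere_pos (n := n)).ne'

lemma ae_sphereMeasure_norm_eq_one : ∀ᵐ x ∂sphereMeasure n, ‖x‖ = 1 := by
  filter_upwards [ae_restrict_mem isClosed_sphere.measurableSet] with x hx
  simpa using hx

lemma measurePreserving_sphereMeasure
    (L : EuclideanSpace ℝ (Fin (n + 1)) ≃ₗᵢ[ℝ] EuclideanSpace ℝ (Fin (n + 1))) :
    MeasurePreserving L (sphereMeasure n) (sphereMeasure n) := by
  have h := (L.toIsometryEquiv.measurePreserving_hausdorffMeasure (n : ℝ)).restrict_preimage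
    (isClosed_sphere (x := (0 : EuclideanSpace ℝ (Fin (n + 1)))) (ε := 1)).measurableSet
  have hpre : L.toIsometryEquiv ⁻¹' sphere (0 : EuclideanSpace ℝ (Fin (n + 1))) 1 = sphere 0 1 := by
    ext x; simp
  rw [hpre] at h
  exact h

lemma setAverage_sphere_hausdorffMeasure {r : ℝ} (hr : 0 < r)
    (f : EuclideanSpace ℝ (Fin (n + 1)) → ℝ) :
    ⨍ y in sphere 0 r, f y ∂(Measure.hausdorffMeasure (n : ℝ)) =
      ⨍ y, f (r • y) ∂sphereMeasure n := by
  have hmap : (Measure.hausdorffMeasure (n : ℝ)).restrict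
        (sphere (0 : EuclideanSpace ℝ (Fin (n + 1))) r) =
      (‖r‖₊ ^ (n : ℝ)) • (sphereMeasure n).map (fun y => r • y) := by
    ext A hA
    have hm : Measurable fun y : EuclideanSpace ℝ (Fin (n + 1)) => r • y := by fun_prop
    rw [Measure.restrict_apply hA, Measure.smul_apply, Measure.map_apply hm hA, sphereMeasure,
      Measure.restrict_apply (hm hA),
      ← Measure.hausdorffMeasure_smul₀ n.cast_nonneg hr.ne']
    congr 1
    rw [← Set.image_smul]
    ext y
    constructor
    · rintro ⟨hyA, hy⟩
      refine ⟨r⁻¹ • y, ⟨by simpa [hr.ne'] using hyA, ?_⟩, by simp [hr.ne']⟩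
      have : ‖y‖ = r := by simpa using hy
      simp [norm_smul, abs_of_pos hr, this, hr.ne']
    · rintro ⟨z, ⟨hzA, hz⟩, rfl⟩
      refine ⟨hzA, ?_⟩
      have : ‖z‖ = 1 := by simpa using hz
      simp [norm_smul, abs_of_pos hr, this]
  have hc : ((‖r‖₊ ^ (n : ℝ) : NNReal) : ℝ) ≠ 0 := by
    simpa using (pow_pos hr n).ne'
  have hemb : MeasurableEmbedding fun y : EuclideanSpace ℝ (Fin (n + 1)) => r • y :=
    measurableEmbedding_const_smul₀ hr.ne'
  rw [average_eq, average_eq, hmap, measureReal_nnreal_smul_apply, integral_smul_nnreal_measure,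
    hemb.integral_map, map_measureReal_apply hemb.measurable MeasurableSet.univ, Set.preimage_univ]
  simp only [smul_eq_mul, NNReal.smul_def]
  field_simp

end EuclideanSpace

/-- The Gaussian moment `∫ ‖x‖^s exp (-‖x‖^2)`. -/
noncomputable def gaussianMoment (E : Type*) [NormedAddCommGroup E] [MeasureSpace E] (s : ℝ) :
    ENNReal :=
  ∫⁻ x : E, ‖x‖ₑ ^ s * ENNReal.ofReal (exp (-‖x‖ ^ 2))

section GaussianMoment

variable {E : Type*} [NormedAddCommGroup E] [NormedSpace ℝ E] [Nontrivial E]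
  [FiniteDimensional ℝ E] [MeasureSpace E] [BorelSpace E]
  [(volume : Measure E).IsAddHaarMeasure]

lemma gaussianMoment_eq {s : ℝ} (hs : 0 < Module.finrank ℝ E + s) :
    gaussianMoment E s = ENNReal.ofReal (Module.finrank ℝ E * (volume : Measure E).real (ball 0 1) *
      (1 / 2 * Gamma ((Module.finrank ℝ E + s) / 2))) := by
  have hD : 0 < Module.finrank ℝ E := Module.finrank_pos
  have hae : (fun x : E => ‖x‖ₑ ^ s * ENNReal.ofReal (exp (-‖x‖ ^ 2))) =ᵐ[volume]
      fun x => ENNReal.ofReal (‖x‖ ^ s * exp (-‖x‖ ^ 2)) := by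
    filter_upwards [compl_mem_ae_iff.2 (measure_singleton (0 : E))] with x hx
    have hx' : 0 < ‖x‖ := norm_pos_iff.2 hx
    rw [ENNReal.ofReal_mul (by positivity), ← ofReal_norm,
      ENNReal.ofReal_rpow_of_pos hx']
  have hpow : ∀ y ∈ Set.Ioi (0 : ℝ), y ^ (Module.finrank ℝ E - 1) • (y ^ s * exp (-y ^ 2)) =
      y ^ (Module.finrank ℝ E + s - 1) * exp (-y ^ (2 : ℝ)) := by
    intro y hy
    rw [smul_eq_mul, ← mul_assoc, ← rpow_natCast, ← rpow_add hy, Nat.cast_sub hD, rpow_two]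
    congr 2
    push_cast
    ring
  have hint : Integrable (fun x : E => ‖x‖ ^ s * exp (-‖x‖ ^ 2)) := by
    rw [integrable_fun_norm_addHaar volume (f := fun y => y ^ s * exp (-y ^ 2)),
      integrableOn_congr_fun hpow measurableSet_Ioi]
    exact integrableOn_rpow_mul_exp_neg_rpow (by linarith) (by norm_num)
  rw [gaussianMoment, lintegral_congr_ae hae, ← ofReal_integral_eq_lintegral_ofReal hint
    (Eventually.of_forall fun x => by positivity),
    integral_fun_norm_addHaar volume (fun y => y ^ s * exp (-y ^ 2)),
    setIntegral_congr_fun measurableSet_Ioi hpow,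
    integral_rpow_mul_exp_neg_rpow (by norm_num) (by linarith)]
  simp only [nsmul_eq_mul, smul_eq_mul, sub_add_cancel, mul_assoc]

lemma gaussianMoment_ne_top {s : ℝ} (hs : 0 < Module.finrank ℝ E + s) :
    gaussianMoment E s ≠ ⊤ := by
  rw [gaussianMoment_eq hs]
  exact ENNReal.ofReal_ne_top

lemma gaussianMoment_ne_zero {s : ℝ} (hs : 0 < Module.finrank ℝ E + s) :
    gaussianMoment E s ≠ 0 := by
  have hD : (0 : ℝ) < Module.finrank ℝ E := by exact_mod_cast Module.finrank_pos
  have hB : 0 < (volume : Measure E).real (ball 0 1) :=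
    ENNReal.toReal_pos (measure_ball_pos _ _ one_pos).ne' measure_ball_lt_top.ne
  have := Gamma_pos_of_pos (half_pos hs)
  rw [gaussianMoment_eq hs]
  simp only [ne_eq, ENNReal.ofReal_eq_zero, not_le]
  positivity

lemma gaussianMoment_add_two {s : ℝ} (hs : 0 < Module.finrank ℝ E + s) :
    gaussianMoment E (s + 2) =
      ENNReal.ofReal ((Module.finrank ℝ E + s) / 2) * gaussianMoment E s := by
  rw [gaussianMoment_eq hs, gaussianMoment_eq (by linarith), ← ENNReal.ofReal_mul (by linarith),
    ← add_assoc, add_div _ (2 : ℝ) 2, div_self two_ne_zero, Gamma_add_one (by linarith)]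
  congr 1
  ring

end GaussianMoment

namespace EuclideanSpace

variable {n : ℕ}

lemma inner_single_zero_one (x : EuclideanSpace ℝ (Fin (n + 1))) :
    inner ℝ (single 0 1) x = x 0 := by simp [inner_single_left]

/-- The integral of `|x₀|^s` over the unit sphere. -/
noncomputable def zonalMoment (n : ℕ) (s : ℝ) : ENNReal :=
  ∫⁻ x, ‖x 0‖ₑ ^ s ∂sphereMeasure n

lemma lintegral_enorm_inner_rpow_sphereMeasure (s : ℝ)
    (x : EuclideanSpace ℝ (Fin (n + 1))) :
    ∫⁻ y, ‖inner ℝ x y‖ₑ ^ s ∂sphereMeasure n = ‖x‖ₑ ^ s * zonalMoment n s := by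
  obtain ⟨L, hL⟩ := exists_linearIsometryEquiv_apply_eq
    (v := ‖x‖ • (single 0 1 : EuclideanSpace ℝ (Fin (n + 1)))) (w := x) (by simp [norm_smul])
  rw [← (measurePreserving_sphereMeasure L).lintegral_comp (by fun_prop), zonalMoment,
    ← lintegral_const_mul _ (by fun_prop)]
  refine lintegral_congr fun y => ?_
  nth_rewrite 1 [← hL]
  rw [L.inner_map_map, inner_smul_left, inner_single_zero_one, enorm_mul,
    ENNReal.mul_rpow_of_ne_top (by simp) (by simp)]
  simp

lemma lintegral_enorm_inner_rpow_mul_gaussian (s : ℝ) {y : EuclideanSpace ℝ (Fin (n + 1))}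
    (hy : ‖y‖ = 1) :
    ∫⁻ x, ‖inner ℝ x y‖ₑ ^ s * ENNReal.ofReal (exp (-‖x‖ ^ 2)) =
      gaussianMoment ℝ s * ∫⁻ z : Fin n → ℝ, ENNReal.ofReal (exp (-∑ i, z i ^ 2)) := by
  obtain ⟨L, hL⟩ := exists_linearIsometryEquiv_apply_eq
    (v := (single 0 1 : EuclideanSpace ℝ (Fin (n + 1)))) (w := y) (by simp [hy])
  rw [← L.measurePreserving.lintegral_comp (by fun_prop)]
  simp only [← hL, L.inner_map_map, L.norm_map]
  simp only [real_inner_comm (single 0 1 : EuclideanSpace ℝ (Fin (n + 1))),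
    inner_single_zero_one]
  rw [← (PiLp.volume_preserving_toLp (Fin (n + 1))).lintegral_comp (by fun_prop),
    ← (volume_preserving_piFinSuccAbove (fun _ : Fin (n + 1) => ℝ) 0).symm.lintegral_comp
      (by fun_prop), gaussianMoment, ← lintegral_prod_mul (by fun_prop)
      (Measurable.aemeasurable (by fun_prop))]
  refine lintegral_congr fun z => ?_
  rw [EuclideanSpace.norm_sq_eq, Fin.sum_univ_succ, mul_assoc, ← ENNReal.ofReal_mul (exp_pos _).le,
    ← exp_add]
  simp [MeasurableEquiv.piFinSuccAbove]
  ring_nf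

lemma gaussianMoment_mul_zonalMoment (s : ℝ) :
    gaussianMoment (EuclideanSpace ℝ (Fin (n + 1))) s * zonalMoment n s =
      gaussianMoment ℝ s * (∫⁻ z : Fin n → ℝ, ENNReal.ofReal (exp (-∑ i, z i ^ 2))) *
        sphereMeasure n Set.univ := by
  calc gaussianMoment (EuclideanSpace ℝ (Fin (n + 1))) s * zonalMoment n s
      = ∫⁻ x, ∫⁻ y, ‖inner ℝ x y‖ₑ ^ s * ENNReal.ofReal (exp (-‖x‖ ^ 2)) ∂sphereMeasure n := by
        rw [gaussianMoment, ← lintegral_mul_const _ (by fun_prop)]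
        refine lintegral_congr fun x => ?_
        rw [lintegral_mul_const _ (by fun_prop), lintegral_enorm_inner_rpow_sphereMeasure s x]
        ring
    _ = ∫⁻ y, ∫⁻ x, ‖inner ℝ x y‖ₑ ^ s * ENNReal.ofReal (exp (-‖x‖ ^ 2)) ∂volume
          ∂sphereMeasure n := lintegral_lintegral_swap (by fun_prop)
    _ = _ := by
        rw [← lintegral_const]
        refine lintegral_congr_ae ?_
        filter_upwards [ae_sphereMeasure_norm_eq_one] with y hy
        exact lintegral_enorm_inner_rpow_mul_gaussian s hy

lemma lintegral_gaussian_ne_top :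
    ∫⁻ z : Fin n → ℝ, ENNReal.ofReal (exp (-∑ i, z i ^ 2)) ≠ ⊤ := by
  have h := gaussianMoment_mul_zonalMoment (n := n) 0
  have h1 : gaussianMoment (EuclideanSpace ℝ (Fin (n + 1))) 0 ≠ ⊤ :=
    gaussianMoment_ne_top (by simp; positivity)
  have h2 : gaussianMoment ℝ 0 ≠ 0 := gaussianMoment_ne_zero (by simp)
  intro htop
  rw [htop, ENNReal.mul_top h2, ENNReal.top_mul sphereMeasure_univ_ne_zero] at h
  refine (ENNReal.mul_ne_top h1 ?_) h
  simp [zonalMoment]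

lemma zonalMoment_ne_top {s : ℝ} (hs : -1 < s) : zonalMoment n s ≠ ⊤ := by
  intro htop
  have h := gaussianMoment_mul_zonalMoment (n := n) s
  have h1 : gaussianMoment (EuclideanSpace ℝ (Fin (n + 1))) s ≠ 0 :=
    gaussianMoment_ne_zero (by
      have : (0 : ℝ) ≤ n := n.cast_nonneg
      simp; linarith)
  have h2 : gaussianMoment ℝ s ≠ ⊤ := gaussianMoment_ne_top (by simp; linarith)
  rw [htop, ENNReal.mul_top h1] at h
  exact ENNReal.mul_ne_top (ENNReal.mul_ne_top h2 lintegral_gaussian_ne_top)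
    (measure_ne_top _ _) h.symm

lemma zonalMoment_add_two {s : ℝ} (hs : -1 < s) :
    ENNReal.ofReal (n + 1 + s) * zonalMoment n (s + 2) =
      ENNReal.ofReal (1 + s) * zonalMoment n s := by
  have hn : (0 : ℝ) ≤ n := n.cast_nonneg
  have hE : 0 < Module.finrank ℝ (EuclideanSpace ℝ (Fin (n + 1))) + s := by
    simp; linarith
  have hR : 0 < Module.finrank ℝ ℝ + s := by simp; linarith
  have h1 := gaussianMoment_mul_zonalMoment (n := n) s
  have h2 := gaussianMoment_mul_zonalMoment (n := n) (s + 2)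
  rw [gaussianMoment_add_two hE, gaussianMoment_add_two hR, mul_assoc (ENNReal.ofReal _),
    mul_assoc (ENNReal.ofReal _), mul_assoc (ENNReal.ofReal _), ← h1] at h2
  simp only [finrank_euclideanSpace, Fintype.card_fin, Nat.cast_add, Nat.cast_one,
    Module.finrank_self] at h2
  rw [ENNReal.ofReal_div_of_pos two_pos, ENNReal.ofReal_div_of_pos two_pos] at h2
  have hI0 := gaussianMoment_ne_zero hE
  have hI1 := gaussianMoment_ne_top hE
  have h20 : (ENNReal.ofReal 2)⁻¹ ≠ 0 := by simp
  have h21 : (ENNReal.ofReal 2)⁻¹ ≠ ⊤ := by simp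
  refine (ENNReal.mul_right_inj (mul_ne_zero h20 hI0) (ENNReal.mul_ne_top h21 hI1)).1 ?_
  simp only [div_eq_mul_inv] at h2
  calc _ = _ := by ring
    _ = _ := h2
    _ = _ := by ring

lemma ae_sphereMeasure_apply_zero_ne_zero : ∀ᵐ x ∂sphereMeasure n, x 0 ≠ 0 := by
  filter_upwards [ae_lt_top (by fun_prop) (zonalMoment_ne_top (n := n) (s := -1 / 2) (by norm_num))]
    with x hx h0
  rw [h0, enorm_zero, ENNReal.zero_rpow_of_neg (by norm_num)] at hx
  exact lt_irrefl _ hx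

lemma ofReal_abs_rpow_ae_eq (s : ℝ) :
    (fun x => ENNReal.ofReal (|x 0| ^ s)) =ᵐ[sphereMeasure n] fun x => ‖x 0‖ₑ ^ s := by
  filter_upwards [ae_sphereMeasure_apply_zero_ne_zero] with x hx
  rw [← ENNReal.ofReal_rpow_of_pos (abs_pos.2 hx), ← norm_eq_abs, ofReal_norm]

lemma integral_abs_rpow_sphereMeasure (s : ℝ) :
    ∫ x, |x 0| ^ s ∂sphereMeasure n = (zonalMoment n s).toReal := by
  rw [integral_eq_lintegral_of_nonneg_ae (Eventually.of_forall fun x => by positivity)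
    (Measurable.aestronglyMeasurable (by fun_prop)), lintegral_congr_ae (ofReal_abs_rpow_ae_eq s),
    zonalMoment]

lemma integrable_abs_rpow_sphereMeasure {s : ℝ} (hs : -1 < s) :
    Integrable (fun x => |x 0| ^ s) (sphereMeasure n) := by
  refine ⟨Measurable.aestronglyMeasurable (by fun_prop), ?_⟩
  rw [hasFiniteIntegral_iff_ofReal (Eventually.of_forall fun x => by positivity),
    lintegral_congr_ae (ofReal_abs_rpow_ae_eq s)]
  exact (zonalMoment_ne_top hs).lt_top

lemma integral_abs_rpow_add_two_sphereMeasure {s : ℝ} (hs : -1 < s) :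
    (n + 1 + s) * ∫ x, |x 0| ^ (s + 2) ∂sphereMeasure n =
      (1 + s) * ∫ x, |x 0| ^ s ∂sphereMeasure n := by
  have hn : (0 : ℝ) ≤ n := n.cast_nonneg
  have h := congrArg ENNReal.toReal (zonalMoment_add_two (n := n) hs)
  rw [ENNReal.toReal_mul, ENNReal.toReal_mul, ENNReal.toReal_ofReal (by linarith),
    ENNReal.toReal_ofReal (by linarith)] at h
  rw [integral_abs_rpow_sphereMeasure, integral_abs_rpow_sphereMeasure, h]

lemma integral_abs_rpow_sphereMeasure_pos {s : ℝ} (hs : -1 < s) :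
    0 < ∫ x, |x 0| ^ s ∂sphereMeasure n := by
  have h0 : 0 ≤ᵐ[sphereMeasure n] fun x => |x 0| ^ s :=
    Eventually.of_forall fun x => by positivity
  refine (integral_nonneg_of_ae h0).lt_of_ne' fun h => ?_
  rw [integral_eq_zero_iff_of_nonneg_ae h0 (integrable_abs_rpow_sphereMeasure hs)] at h
  have hfalse : ∀ᵐ x ∂sphereMeasure n, False := by
    filter_upwards [h, ae_sphereMeasure_apply_zero_ne_zero] with x hx hx0
    exact (rpow_pos_of_pos (abs_pos.2 hx0) s).ne' hx
  refine sphereMeasure_univ_ne_zero (n := n) ?_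
  simpa [ae_iff] using hfalse

lemma integrable_abs_rpow_mul_apply_mul_apply {s : ℝ} (hs : -1 < s) (i j : Fin (n + 1)) :
    Integrable (fun x => |x 0| ^ s * (x i * x j)) (sphereMeasure n) := by
  refine (integrable_abs_rpow_sphereMeasure hs).mono
    (Measurable.aestronglyMeasurable (by fun_prop)) ?_
  filter_upwards [ae_sphereMeasure_norm_eq_one] with x hx
  have hi : ∀ k, ‖x k‖ ≤ 1 := fun k => hx ▸ PiLp.norm_apply_le x k
  rw [norm_mul, norm_mul]
  exact mul_le_of_le_one_right (norm_nonneg _) (mul_le_one₀ (hi i) (norm_nonneg _) (hi j))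

lemma integral_abs_rpow_mul_apply_mul_apply_of_ne (s : ℝ) {i j : Fin (n + 1)} (hij : i ≠ j) :
    ∫ x, |x 0| ^ s * (x i * x j) ∂sphereMeasure n = 0 := by
  let L : EuclideanSpace ℝ (Fin (n + 1)) ≃ₗᵢ[ℝ] EuclideanSpace ℝ (Fin (n + 1)) :=
    LinearIsometryEquiv.piLpCongrRight 2 fun k =>
      if k = i then LinearIsometryEquiv.neg ℝ else LinearIsometryEquiv.refl ℝ ℝ
  have hL : ∀ x k, L x k = if k = i then -x k else x k := by
    intro x k
    simp only [L, LinearIsometryEquiv.piLpCongrRight_apply]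
    split_ifs <;> simp
  have h := (measurePreserving_sphereMeasure L).integral_comp
    L.toHomeomorph.measurableEmbedding fun x => |x 0| ^ s * (x i * x j)
  have habs : ∀ x, |L x 0| = |x 0| := by
    intro x
    rw [hL]
    split_ifs <;> simp
  simp only [habs] at h
  simp only [hL, if_true, if_neg hij.symm, neg_mul, mul_neg, integral_neg] at h
  linarith

lemma integral_abs_rpow_mul_apply_mul_self_eq (s : ℝ) {i j : Fin (n + 1)} (hi : i ≠ 0)
    (hj : j ≠ 0) :
    ∫ x, |x 0| ^ s * (x i * x i) ∂sphereMeasure n =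
      ∫ x, |x 0| ^ s * (x j * x j) ∂sphereMeasure n := by
  let L : EuclideanSpace ℝ (Fin (n + 1)) ≃ₗᵢ[ℝ] EuclideanSpace ℝ (Fin (n + 1)) :=
    LinearIsometryEquiv.piLpCongrLeft 2 ℝ ℝ (Equiv.swap i j)
  have hL : ∀ x k, L x k = x (Equiv.swap i j k) := fun x k => by
    simp [L, LinearIsometryEquiv.piLpCongrLeft_apply, Equiv.piCongrLeft']
  rw [← (measurePreserving_sphereMeasure L).integral_comp L.toHomeomorph.measurableEmbedding]
  simp only [hL, Equiv.swap_apply_left, Equiv.swap_apply_of_ne_of_ne hi.symm hj.symm]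

lemma integral_abs_rpow_mul_apply_mul_self {p : ℝ} (hp : 1 < p) (i : Fin (n + 1)) :
    (p - 1) * ∫ x, |x 0| ^ (p - 2) * (x i * x i) ∂sphereMeasure n =
      (if i = 0 then p - 1 else 1) * ∫ x, |x 0| ^ p ∂sphereMeasure n := by
  have h0 : ∫ x, |x 0| ^ (p - 2) * (x 0 * x 0) ∂sphereMeasure n =
      ∫ x, |x 0| ^ p ∂sphereMeasure n := by
    refine integral_congr_ae ?_
    filter_upwards [ae_sphereMeasure_apply_zero_ne_zero] with x hx
    rw [← abs_mul_abs_self, ← sq, ← rpow_two, ← rpow_add (abs_pos.2 hx), sub_add_cancel]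
  split_ifs with hi
  · rw [hi, h0]
  have hsum : ∑ k, ∫ x, |x 0| ^ (p - 2) * (x k * x k) ∂sphereMeasure n =
      ∫ x, |x 0| ^ (p - 2) ∂sphereMeasure n := by
    rw [← integral_finsetSum _ fun k _ =>
      integrable_abs_rpow_mul_apply_mul_apply (by linarith) k k]
    refine integral_congr_ae ?_
    filter_upwards [ae_sphereMeasure_norm_eq_one] with x hx
    have : ∑ k, x k * x k = 1 := by
      have := EuclideanSpace.norm_sq_eq x
      simp only [hx, norm_eq_abs, sq_abs] at this
      simp only [← sq, ← this, one_pow]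
    rw [← Finset.mul_sum, this, mul_one]
  have hmom := integral_abs_rpow_add_two_sphereMeasure (n := n) (s := p - 2) (by linarith)
  have hconst : ∀ k : Fin n, ∫ x, |x 0| ^ (p - 2) * (x k.succ * x k.succ) ∂sphereMeasure n =
      ∫ x, |x 0| ^ (p - 2) * (x i * x i) ∂sphereMeasure n := fun k =>
    integral_abs_rpow_mul_apply_mul_self_eq _ k.succ_ne_zero hi
  rw [Fin.sum_univ_succ, h0, Finset.sum_congr rfl fun k _ => hconst k] at hsum
  simp only [Finset.sum_const, Finset.card_univ, Fintype.card_fin, nsmul_eq_mul] at hsum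
  rw [← hsum, sub_add_cancel] at hmom
  have hn : (n : ℝ) ≠ 0 := by
    obtain ⟨k, -⟩ := Fin.exists_succ_eq.2 hi
    exact_mod_cast k.pos.ne'
  refine mul_left_cancel₀ hn ?_
  linear_combination -hmom

lemma integral_abs_rpow_mul_bilin {p : ℝ} (hp : 1 < p)
    (B : EuclideanSpace ℝ (Fin (n + 1)) →ₗ[ℝ] EuclideanSpace ℝ (Fin (n + 1)) →ₗ[ℝ] ℝ) :
    (p - 1) * ∫ x, |x 0| ^ (p - 2) * B x x ∂sphereMeasure n =
      ((p - 2) * B (single 0 1) (single 0 1) + ∑ i, B (single i 1) (single i 1)) *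
        ∫ x, |x 0| ^ p ∂sphereMeasure n := by
  have hB : ∀ x, |x 0| ^ (p - 2) * B x x = ∑ i, ∑ j, |x 0| ^ (p - 2) * (x i * x j) *
      B (single i 1) (single j 1) := by
    intro x
    have hx : x = ∑ i, x i • (single i 1 : EuclideanSpace ℝ (Fin (n + 1))) := by
      simpa using ((EuclideanSpace.basisFun (Fin (n + 1)) ℝ).sum_repr x).symm
    nth_rewrite 2 3 [hx]
    simp only [map_sum, LinearMap.sum_apply, map_smul, LinearMap.smul_apply, smul_eq_mul,
      Finset.mul_sum]
    rw [Finset.sum_comm]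
    refine Finset.sum_congr rfl fun i _ => Finset.sum_congr rfl fun j _ => by ring
  have hint : ∀ i j, Integrable (fun x => |x 0| ^ (p - 2) * (x i * x j) *
      B (single i 1) (single j 1)) (sphereMeasure n) := fun i j =>
    (integrable_abs_rpow_mul_apply_mul_apply (by linarith) i j).mul_const _
  simp only [hB]
  rw [integral_finsetSum _ fun i _ => integrable_finsetSum _ fun j _ => hint i j]
  have hrow : ∀ i, ∫ x, ∑ j, |x 0| ^ (p - 2) * (x i * x j) *
      B (single i 1) (single j 1) ∂sphereMeasure n =
      (∫ x, |x 0| ^ (p - 2) * (x i * x i) ∂sphereMeasure n) * B (single i 1) (single i 1) := by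
    intro i
    rw [integral_finsetSum _ fun j _ => hint i j, Finset.sum_eq_single i, integral_mul_const]
    · intro j _ hj
      rw [integral_mul_const, integral_abs_rpow_mul_apply_mul_apply_of_ne _ hj.symm, zero_mul]
    · simp
  simp only [hrow]
  have hterm : ∀ i, (p - 1) * ((∫ x, |x 0| ^ (p - 2) * (x i * x i) ∂sphereMeasure n) *
      B (single i 1) (single i 1)) =
      (∫ x, |x 0| ^ p ∂sphereMeasure n) *
        ((if i = 0 then p - 1 else 1) * B (single i 1) (single i 1)) := fun i => by
    rw [← mul_assoc, integral_abs_rpow_mul_apply_mul_self hp]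
    ring
  rw [Finset.mul_sum, Finset.sum_congr rfl fun i _ => hterm i, ← Finset.mul_sum,
    Fin.sum_univ_succ, Fin.sum_univ_succ]
  simp only [if_true, Fin.succ_ne_zero, if_false, one_mul]
  ring

lemma sum_bilin_orthonormalBasis {E ι κ : Type*} [NormedAddCommGroup E] [InnerProductSpace ℝ E]
    [FiniteDimensional ℝ E] [Fintype ι] [Fintype κ] (B : E →ₗ[ℝ] E →ₗ[ℝ] ℝ)
    (v : OrthonormalBasis ι ℝ E) (w : OrthonormalBasis κ ℝ E) :
    ∑ i, B (v i) (v i) = ∑ i, B (w i) (w i) := by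
  have h := congrArg (TensorProduct.lift B)
    ((InnerProductSpace.canonicalCovariantTensor_eq_sum E v).symm.trans
      (InnerProductSpace.canonicalCovariantTensor_eq_sum E w))
  simpa using h

lemma integrable_abs_inner_rpow {s : ℝ} (hs : -1 < s) (q : EuclideanSpace ℝ (Fin (n + 1))) :
    Integrable (fun x => |inner ℝ q x| ^ s) (sphereMeasure n) := by
  obtain ⟨L, hL⟩ := exists_linearIsometryEquiv_apply_eq
    (v := ‖q‖ • (single 0 1 : EuclideanSpace ℝ (Fin (n + 1)))) (w := q) (by simp [norm_smul])
  rw [← (measurePreserving_sphereMeasure L).integrable_comp_emb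
    L.toHomeomorph.measurableEmbedding]
  refine ((integrable_abs_rpow_sphereMeasure (n := n) hs).const_mul (‖q‖ ^ s)).congr
    (Eventually.of_forall fun y => ?_)
  simp only [Function.comp_apply]
  nth_rewrite 2 [← hL]
  rw [L.inner_map_map, inner_smul_left, inner_single_zero_one, abs_mul,
    mul_rpow (abs_nonneg _) (abs_nonneg _)]
  simp

lemma ae_sphereMeasure_inner_ne_zero {q : EuclideanSpace ℝ (Fin (n + 1))} (hq : q ≠ 0) :
    ∀ᵐ x ∂sphereMeasure n, inner ℝ q x ≠ 0 := by
  obtain ⟨L, hL⟩ := exists_linearIsometryEquiv_apply_eq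
    (v := q) (w := ‖q‖ • (single 0 1 : EuclideanSpace ℝ (Fin (n + 1)))) (by simp [norm_smul])
  filter_upwards [(measurePreserving_sphereMeasure L).quasiMeasurePreserving.ae
    ae_sphereMeasure_apply_zero_ne_zero] with x hx
  rw [← L.inner_map_map, hL, inner_smul_left, inner_single_zero_one]
  exact mul_ne_zero (by simpa using hq) hx

lemma integral_abs_inner_rpow_mul_bilin {p : ℝ} (hp : 1 < p)
    (B : EuclideanSpace ℝ (Fin (n + 1)) →ₗ[ℝ] EuclideanSpace ℝ (Fin (n + 1)) →ₗ[ℝ] ℝ)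
    {q : EuclideanSpace ℝ (Fin (n + 1))} (hq : q ≠ 0) :
    (p - 1) * ∫ x, |inner ℝ q x| ^ (p - 2) * B x x ∂sphereMeasure n =
      (‖q‖ ^ (p - 2) * ∑ i, B (single i 1) (single i 1) + (p - 2) * ‖q‖ ^ (p - 4) * B q q) *
        ∫ x, |x 0| ^ p ∂sphereMeasure n := by
  obtain ⟨L, hL⟩ := exists_linearIsometryEquiv_apply_eq
    (v := ‖q‖ • (single 0 1 : EuclideanSpace ℝ (Fin (n + 1)))) (w := q) (by simp [norm_smul])
  set C := B.compl₁₂ L.toLinearEquiv.toLinearMap L.toLinearEquiv.toLinearMap with hC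
  have hCB : ∀ x y, C x y = B (L x) (L y) := fun x y => rfl
  have hqpos : 0 < ‖q‖ := norm_pos_iff.2 hq
  have h1 : ∀ y, |inner ℝ q (L y)| ^ (p - 2) * B (L y) (L y) =
      ‖q‖ ^ (p - 2) * (|y 0| ^ (p - 2) * C y y) := by
    intro y
    nth_rewrite 1 [← hL]
    rw [L.inner_map_map, inner_smul_left, inner_single_zero_one, abs_mul,
      mul_rpow (abs_nonneg _) (abs_nonneg _), hCB]
    simp only [conj_trivial, abs_norm]
    ring
  have htr : ∑ i, C (single i 1) (single i 1) = ∑ i, B (single i 1) (single i 1) := by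
    simpa [hCB] using sum_bilin_orthonormalBasis B
      ((EuclideanSpace.basisFun (Fin (n + 1)) ℝ).map L) (EuclideanSpace.basisFun (Fin (n + 1)) ℝ)
  have hqq : B q q = ‖q‖ ^ 2 * C (single 0 1) (single 0 1) := by
    nth_rewrite 1 2 [← hL]
    rw [← hCB]
    simp only [map_smul, LinearMap.smul_apply, smul_eq_mul]
    ring
  have hpow : ‖q‖ ^ (p - 2) = ‖q‖ ^ (p - 4) * ‖q‖ ^ 2 := by
    rw [← rpow_two, ← rpow_add hqpos]
    congr 1
    ring
  rw [← (measurePreserving_sphereMeasure L).integral_comp L.toHomeomorph.measurableEmbedding]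
  simp only [h1, integral_const_mul]
  rw [mul_left_comm, integral_abs_rpow_mul_bilin hp C, htr, hqq, hpow]
  ring

lemma integral_signedPow_inner (p : ℝ) (q : EuclideanSpace ℝ (Fin (n + 1))) :
    ∫ y, signedPow p (inner ℝ q y) ∂sphereMeasure n = 0 := by
  have h := (measurePreserving_sphereMeasure (n := n) (LinearIsometryEquiv.neg ℝ)).integral_comp
    (LinearIsometryEquiv.neg ℝ).toHomeomorph.measurableEmbedding
    fun y => signedPow p (inner ℝ q y)
  simp only [LinearIsometryEquiv.coe_neg, inner_neg_right, signedPow.neg, integral_neg] at h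
  linarith

lemma integrable_signedPow_inner {p : ℝ} (hp : 1 < p) (q : EuclideanSpace ℝ (Fin (n + 1))) :
    Integrable (fun y => signedPow p (inner ℝ q y)) (sphereMeasure n) := by
  refine (integrable_abs_inner_rpow (s := p - 1) (by linarith) q).mono
    ((signedPow.measurable p).comp (by fun_prop)).aestronglyMeasurable
    (Eventually.of_forall fun y => ?_)
  rw [norm_eq_abs, signedPow.abs_eq hp]
  exact le_abs_self _

lemma exists_taylor_bound {E : Type*} [NormedAddCommGroup E] [InnerProductSpace ℝ E]
    [CompleteSpace E] {φ : E → ℝ} {x : E} (hφ : ContDiffAt ℝ 2 φ x) :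
    ∃ M, ∀ᶠ r in nhdsWithin (0 : ℝ) (Set.Ioi 0), ∀ y : E, ‖y‖ = 1 →
      |(φ (x + r • y) - φ x) / r - inner ℝ (gradient φ x) y| ≤ M * r := by
  obtain ⟨δ, hδ, h⟩ := exists_taylor_two_remainder_le hφ one_pos
  refine ⟨1 + ‖iteratedFDeriv ℝ 2 φ x‖ / 2, ?_⟩
  filter_upwards [self_mem_nhdsWithin, mem_nhdsWithin_of_mem_nhds (gt_mem_nhds hδ)]
    with r hr hrδ y hy
  have hr0 : 0 < r := hr
  have hn : ‖r • y‖ = r := by rw [norm_smul, hy, mul_one, norm_of_nonneg hr0.le]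
  have h1 := h (r • y) (hn.symm ▸ hrδ)
  have h2 := (iteratedFDeriv ℝ 2 φ x).le_opNorm ![r • y, r • y]
  simp only [Fin.prod_univ_two, Matrix.cons_val_zero, Matrix.cons_val_one, hn, norm_eq_abs] at h2
  rw [hn, inner_smul_right] at h1
  have h3 : (φ (x + r • y) - φ x) / r - inner ℝ (gradient φ x) y =
      (φ (x + r • y) - φ x - r * inner ℝ (gradient φ x) y) / r := by
    field_simp
  rw [h3, abs_div, abs_of_pos hr0, div_le_iff₀ hr0]
  rw [abs_le] at *
  constructor <;> linarith [h1.1, h1.2, h2.1, h2.2]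

lemma tendsto_taylor_quotient {E : Type*} [NormedAddCommGroup E] [InnerProductSpace ℝ E]
    [CompleteSpace E] {φ : E → ℝ} {x : E} (hφ : ContDiffAt ℝ 2 φ x) {y : E} (hy : ‖y‖ = 1) :
    Tendsto (fun r : ℝ => r⁻¹ * ((φ (x + r • y) - φ x) / r - inner ℝ (gradient φ x) y))
      (nhdsWithin 0 (Set.Ioi 0)) (nhds (iteratedFDeriv ℝ 2 φ x ![y, y] / 2)) := by
  rw [Metric.tendsto_nhds]
  intro ε hε
  obtain ⟨δ, hδ, h⟩ := exists_taylor_two_remainder_le hφ (half_pos hε)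
  filter_upwards [self_mem_nhdsWithin, mem_nhdsWithin_of_mem_nhds (gt_mem_nhds hδ)] with r hr hrδ
  have hr0 : 0 < r := hr
  have hn : ‖r • y‖ = r := by rw [norm_smul, hy, mul_one, norm_of_nonneg hr0.le]
  have h1 := h (r • y) (hn.symm ▸ hrδ)
  have h2 : iteratedFDeriv ℝ 2 φ x ![r • y, r • y] = r ^ 2 * iteratedFDeriv ℝ 2 φ x ![y, y] := by
    simp only [iteratedFDeriv_two_apply, Matrix.cons_val_zero, Matrix.cons_val_one, map_smul,
      smul_apply, smul_eq_mul]
    ring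
  rw [hn, inner_smul_right, h2] at h1
  have h3 : r⁻¹ * ((φ (x + r • y) - φ x) / r - inner ℝ (gradient φ x) y) -
      iteratedFDeriv ℝ 2 φ x ![y, y] / 2 =
      (φ (x + r • y) - φ x - r * inner ℝ (gradient φ x) y -
        r ^ 2 * iteratedFDeriv ℝ 2 φ x ![y, y] / 2) / r ^ 2 := by
    field_simp
  rw [Real.dist_eq, h3, abs_div, abs_of_pos (by positivity : 0 < r ^ 2),
    div_lt_iff₀ (by positivity)]
  nlinarith [mul_pos hε (pow_pos hr0 2)]

lemma tendsto_signedPow_quotient {p : ℝ} (hp : 1 < p) {E : Type*} [NormedAddCommGroup E]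
    [InnerProductSpace ℝ E] [CompleteSpace E] {φ : E → ℝ} {x : E} (hφ : ContDiffAt ℝ 2 φ x)
    {y : E} (hy : ‖y‖ = 1) (hqy : inner ℝ (gradient φ x) y ≠ 0) :
    Tendsto (fun r : ℝ => r⁻¹ * (signedPow p ((φ (x + r • y) - φ x) / r) -
        signedPow p (inner ℝ (gradient φ x) y)))
      (nhdsWithin 0 (Set.Ioi 0))
      (nhds ((p - 1) * |inner ℝ (gradient φ x) y| ^ (p - 2) *
        (iteratedFDeriv ℝ 2 φ x ![y, y] / 2))) := by
  set a := inner ℝ (gradient φ x) y with ha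
  set f : ℝ → ℝ := fun r => a + r * (r⁻¹ * ((φ (x + r • y) - φ x) / r - a)) with hf
  have hf0 : f 0 = a := by simp [hf]
  have hfr : ∀ r ∈ Set.Ioi (0 : ℝ), f r = (φ (x + r • y) - φ x) / r := by
    intro r hr
    simp only [hf]
    rw [mul_inv_cancel_left₀ (ne_of_gt hr)]
    ring
  have hfd : HasDerivWithinAt f (iteratedFDeriv ℝ 2 φ x ![y, y] / 2) (Set.Ioi 0) 0 := by
    rw [hasDerivWithinAt_iff_tendsto_slope' Set.self_notMem_Ioi]
    refine (tendsto_taylor_quotient hφ hy).congr' ?_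
    filter_upwards [self_mem_nhdsWithin] with r hr
    rw [slope_def_field, hf0, hfr r hr, sub_zero, div_eq_inv_mul _ r]
    ring
  have hJ := (signedPow.hasDerivAt hp (hf0.symm ▸ hqy)).comp_hasDerivWithinAt (0 : ℝ) hfd
  rw [hasDerivWithinAt_iff_tendsto_slope' Set.self_notMem_Ioi, hf0] at hJ
  refine hJ.congr' ?_
  filter_upwards [self_mem_nhdsWithin] with r hr
  rw [slope_def_field, Function.comp_apply, Function.comp_apply, hf0, hfr r hr, sub_zero,
    div_eq_inv_mul _ r]

lemma tendsto_integral_signedPow {p R : ℝ} (hp1 : 1 < p) (hp2 : p < 2) (hR : 0 < R)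
    {x : EuclideanSpace ℝ (Fin (n + 1))} {φ : EuclideanSpace ℝ (Fin (n + 1)) → ℝ}
    (hφ : ContDiffOn ℝ 2 φ (ball x R)) (hgrad : gradient φ x ≠ 0) :
    Tendsto (fun r : ℝ => (r ^ p)⁻¹ * ∫ y, signedPow p (φ (x + r • y) - φ x) ∂sphereMeasure n)
      (nhdsWithin 0 (Set.Ioi 0))
      (nhds (∫ y, (p - 1) * |inner ℝ (gradient φ x) y| ^ (p - 2) *
        (iteratedFDeriv ℝ 2 φ x ![y, y] / 2) ∂sphereMeasure n)) := by
  have hφx : ContDiffAt ℝ 2 φ x := hφ.contDiffAt (ball_mem_nhds x hR)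
  set q := gradient φ x with hq
  set G : ℝ → EuclideanSpace ℝ (Fin (n + 1)) → ℝ := fun r y =>
    r⁻¹ * (signedPow p ((φ (x + r • y) - φ x) / r) - signedPow p (inner ℝ q y)) with hG
  obtain ⟨M, hM⟩ := exists_taylor_bound hφx
  have hmeas : ∀ r ∈ Set.Ioo 0 R, AEStronglyMeasurable (G r) (sphereMeasure n) := by
    rintro r ⟨hr0, hrR⟩
    have hcont : ContinuousOn (fun y => φ (x + r • y)) (sphere 0 1) := by
      refine hφ.continuousOn.comp (by fun_prop) fun y hy => ?_
      have hy1 : ‖y‖ = 1 := by simpa using hy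
      simpa [norm_smul, hy1, abs_of_pos hr0] using hrR
    have h1 : AEMeasurable (fun y => φ (x + r • y)) (sphereMeasure n) :=
      hcont.aemeasurable isClosed_sphere.measurableSet
    have h2 := (signedPow.measurable p).comp_aemeasurable ((h1.sub_const (φ x)).div_const r)
    have h3 : Measurable fun y : EuclideanSpace ℝ (Fin (n + 1)) => signedPow p (inner ℝ q y) :=
      (signedPow.measurable p).comp (by fun_prop)
    exact ((h2.sub h3.aemeasurable).const_mul r⁻¹).aestronglyMeasurable
  have hbound : ∀ᶠ r in nhdsWithin (0 : ℝ) (Set.Ioi 0), ∀ᵐ y ∂sphereMeasure n,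
      ‖G r y‖ ≤ 2 * |inner ℝ q y| ^ (p - 2) * M := by
    filter_upwards [self_mem_nhdsWithin, hM] with r hr hMr
    have hr0 : 0 < r := hr
    filter_upwards [ae_sphereMeasure_norm_eq_one, ae_sphereMeasure_inner_ne_zero hgrad]
      with y hy hqy
    rw [hG, norm_eq_abs, abs_mul, abs_of_pos (inv_pos.2 hr0), inv_mul_le_iff₀ hr0]
    calc _ ≤ 2 * |inner ℝ q y| ^ (p - 2) * |(φ (x + r • y) - φ x) / r - inner ℝ q y| :=
          signedPow.abs_sub_le hp1 hp2 hqy _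
      _ ≤ 2 * |inner ℝ q y| ^ (p - 2) * (M * r) := by
          gcongr
          exact hMr y hy
      _ = _ := by ring
  have hbint : Integrable (fun y => 2 * |inner ℝ q y| ^ (p - 2) * M) (sphereMeasure n) :=
    ((integrable_abs_inner_rpow (by linarith) q).const_mul 2).mul_const M
  have hIoo : ∀ᶠ r in nhdsWithin (0 : ℝ) (Set.Ioi 0), r ∈ Set.Ioo 0 R := Ioo_mem_nhdsGT hR
  have hlim : Tendsto (fun r => ∫ y, G r y ∂sphereMeasure n) (nhdsWithin 0 (Set.Ioi 0))
      (nhds (∫ y, (p - 1) * |inner ℝ q y| ^ (p - 2) *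
        (iteratedFDeriv ℝ 2 φ x ![y, y] / 2) ∂sphereMeasure n)) := by
    refine tendsto_integral_filter_of_dominated_convergence _ (hIoo.mono hmeas) hbound hbint ?_
    filter_upwards [ae_sphereMeasure_norm_eq_one, ae_sphereMeasure_inner_ne_zero hgrad]
      with y hy hqy
    exact tendsto_signedPow_quotient hp1 hφx hy hqy
  refine hlim.congr' ?_
  filter_upwards [hIoo, hbound] with r hr hb
  have hr0 : 0 < r := hr.1
  have hGint : Integrable (G r) (sphereMeasure n) := hbint.mono' (hmeas r hr) hb
  have hpow : r ^ p = r * r ^ (p - 1) := by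
    rw [← rpow_one_add' hr0.le (by linarith)]
    congr 1
    ring
  have hdecomp : ∀ y, (r ^ p)⁻¹ * signedPow p (φ (x + r • y) - φ x) =
      G r y + r⁻¹ * signedPow p (inner ℝ q y) := by
    intro y
    have h1 : φ (x + r • y) - φ x = r * ((φ (x + r • y) - φ x) / r) := by field_simp
    have h2 : r ^ (p - 1) ≠ 0 := (rpow_pos_of_pos hr0 _).ne'
    rw [h1, signedPow.mul, signedPow.of_nonneg hp1 hr0.le, hpow]
    simp only [hG]
    generalize signedPow p ((φ (x + r • y) - φ x) / r) = a
    field_simp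
    ring
  have hodd : ∫ y, r⁻¹ * signedPow p (inner ℝ q y) ∂sphereMeasure n = 0 := by
    rw [integral_const_mul, integral_signedPow_inner, mul_zero]
  rw [← integral_const_mul]
  simp only [hdecomp]
  rw [integral_add hGint ((integrable_signedPow_inner hp1 q).const_mul _), hodd, add_zero]

end EuclideanSpace

theorem stmt_8 (d : ℕ) (hd : 0 < d) (p R : ℝ) (hp1 : 1 < p) (hp2 : p < 2) (hR : 0 < R)
    (x : EuclideanSpace ℝ (Fin d)) (φ : EuclideanSpace ℝ (Fin d) → ℝ)
    (hφ : ContDiffOn ℝ 2 φ (ball x R)) (hgrad : gradient φ x ≠ 0) :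
    Tendsto
      (fun r : ℝ =>
        (1 / (((1 / 2) * ⨍ y in sphere (0 : EuclideanSpace ℝ (Fin d)) 1,
            |y ⟨0, hd⟩| ^ p ∂μH[(d : ℝ) - 1]) * r ^ p)) *
          ⨍ y in sphere (0 : EuclideanSpace ℝ (Fin d)) r,
            |φ (x + y) - φ x| ^ (p - 2) * (φ (x + y) - φ x) ∂μH[(d : ℝ) - 1])
      (nhdsWithin 0 (Set.Ioi 0))
      (nhds
        (‖gradient φ x‖ ^ (p - 2) *
            (∑ i, iteratedFDeriv ℝ 2 φ x ![EuclideanSpace.single i 1, EuclideanSpace.single i 1]) +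
          (p - 2) * ‖gradient φ x‖ ^ (p - 4) *
            iteratedFDeriv ℝ 2 φ x ![gradient φ x, gradient φ x])) := by
  obtain ⟨n, rfl⟩ : ∃ n, d = n + 1 := Nat.exists_eq_add_one.2 hd
  have hn : ((n + 1 : ℕ) : ℝ) - 1 = n := by push_cast; ring
  rw [hn]
  set K := ∫ y, |y 0| ^ p ∂EuclideanSpace.sphereMeasure n with hK
  have hKpos : 0 < K := EuclideanSpace.integral_abs_rpow_sphereMeasure_pos (by linarith)
  have hσ : (EuclideanSpace.sphereMeasure n).real Set.univ ≠ 0 :=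
    (ENNReal.toReal_pos EuclideanSpace.sphereMeasure_univ_ne_zero (measure_ne_top _ _)).ne'
  have hC : ⨍ y in sphere (0 : EuclideanSpace ℝ (Fin (n + 1))) 1, |y ⟨0, hd⟩| ^ p ∂μH[(n : ℝ)] =
      ((EuclideanSpace.sphereMeasure n).real Set.univ)⁻¹ * K := by
    rw [EuclideanSpace.setAverage_sphere_hausdorffMeasure one_pos, average_eq]
    simp [hK]
  have hquad := EuclideanSpace.integral_abs_inner_rpow_mul_bilin hp1
    (bilinearIteratedFDerivTwo ℝ φ x) hgrad
  simp only [bilinearIteratedFDerivTwo_eq_iteratedFDeriv] at hquad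
  have hlim := (EuclideanSpace.tendsto_integral_signedPow hp1 hp2 hR hφ hgrad).const_mul (2 / K)
  have hval : 2 / K * ∫ y, (p - 1) * |inner ℝ (gradient φ x) y| ^ (p - 2) *
      (iteratedFDeriv ℝ 2 φ x ![y, y] / 2) ∂EuclideanSpace.sphereMeasure n =
      ‖gradient φ x‖ ^ (p - 2) *
            (∑ i, iteratedFDeriv ℝ 2 φ x ![EuclideanSpace.single i 1, EuclideanSpace.single i 1]) +
          (p - 2) * ‖gradient φ x‖ ^ (p - 4) *
            iteratedFDeriv ℝ 2 φ x ![gradient φ x, gradient φ x] := by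
    have hint : ∫ y, (p - 1) * |inner ℝ (gradient φ x) y| ^ (p - 2) *
        (iteratedFDeriv ℝ 2 φ x ![y, y] / 2) ∂EuclideanSpace.sphereMeasure n =
        (p - 1) * (∫ y, |inner ℝ (gradient φ x) y| ^ (p - 2) *
          iteratedFDeriv ℝ 2 φ x ![y, y] ∂EuclideanSpace.sphereMeasure n) / 2 := by
      rw [← integral_const_mul, ← integral_div]
      congr 1
      ext y
      ring
    rw [hint, hquad, ← hK]
    field_simp
  rw [hval] at hlim
  refine hlim.congr' ?_
  filter_upwards [self_mem_nhdsWithin] with r hr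
  have hrp : r ^ p ≠ 0 := (rpow_pos_of_pos hr p).ne'
  rw [hC, EuclideanSpace.setAverage_sphere_hausdorffMeasure hr, average_eq, smul_eq_mul]
  simp only [signedPow]
  field_simp
end

section
/- Let p ∈ (1,2), β > p/(p−1), and φ(x) = |x|^β on ℝ^d. Then lim_{r→0, x→0} (1/r^p) ⨍_{B_r} |φ(x+y)−φ(x)|^{p-2}(φ(x+y)−φ(x)) dy = 0, i.e., for every ε > 0 there exist δ > 0 such that for all 0 < r < δ and |x| < δ, the quantity |(1/r^p)⨍_{B_r} J_p(φ(x+y)−φ(x)) dy| < ε. -/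
open Real MeasureTheory Metric

/-- The odd power `t ↦ |t|^{p-2} t`. -/
noncomputable def oddPow (p t : ℝ) : ℝ := |t| ^ (p - 2) * t

theorem abs_oddPow {p : ℝ} (hp : 1 < p) (t : ℝ) : |oddPow p t| = |t| ^ (p - 1) := by
  rcases eq_or_ne t 0 with rfl | ht
  · simp [oddPow, zero_rpow (sub_pos.2 hp).ne']
  · rw [oddPow, abs_mul, abs_of_nonneg (rpow_nonneg (abs_nonneg t) _),
      ← rpow_add_one (abs_ne_zero.2 ht)]
    ring_nf

theorem oddPow_neg (p t : ℝ) : oddPow p (-t) = -oddPow p t := by simp [oddPow]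

theorem oddPow_mul (p a b : ℝ) : oddPow p (a * b) = oddPow p a * oddPow p b := by
  simp only [oddPow, abs_mul, mul_rpow (abs_nonneg a) (abs_nonneg b)]
  ring

theorem measurable_oddPow (p : ℝ) : Measurable (oddPow p) := by
  unfold oddPow
  fun_prop

theorem abs_rpow_sub_one_le {u q : ℝ} (hu : 0 ≤ u) (hq0 : 0 < q) (hq1 : q ≤ 1) :
    |u ^ q - 1| ≤ |u - 1| := by
  rcases le_total 1 u with h | h
  · have h1 : 1 ≤ u ^ q := one_le_rpow h hq0.le
    have h2 : u ^ q ≤ u := rpow_le_self_of_one_le h hq1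
    rw [abs_of_nonneg (by linarith), abs_of_nonneg (by linarith)]
    linarith
  · have h1 : u ^ q ≤ 1 := rpow_le_one hu h hq0.le
    have h2 : u ≤ u ^ q := self_le_rpow_of_le_one hu h hq1
    rw [abs_of_nonpos (by linarith), abs_of_nonpos (by linarith)]
    linarith

theorem abs_oddPow_one_add_sub_one_le {p : ℝ} (hp1 : 1 < p) (hp2 : p < 2) (t : ℝ) :
    |oddPow p (1 + t) - 1| ≤ 2 * |t| := by
  rcases lt_or_ge (1 + t) 0 with h | h
  · have h1 : |oddPow p (1 + t)| ≤ -t := by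
      rw [abs_oddPow hp1, abs_of_neg h]
      have := abs_rpow_sub_one_le (u := -t) (q := p - 1) (by linarith) (by linarith) (by linarith)
      rw [abs_of_nonneg (by linarith : (0:ℝ) ≤ -t - 1)] at this
      have h3 := (abs_le.1 this).2
      have h4 : (-(1 + t)) ^ (p - 1) ≤ (-t) ^ (p - 1) :=
        rpow_le_rpow (by linarith) (by linarith) (by linarith)
      linarith
    rw [abs_of_neg (by linarith : t < 0)]
    calc |oddPow p (1 + t) - 1| ≤ |oddPow p (1 + t)| + |1| := abs_sub _ _
      _ ≤ 2 * -t := by rw [abs_one]; linarith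
  · have h1 : oddPow p (1 + t) = (1 + t) ^ (p - 1) := by
      have h2 := abs_oddPow hp1 (1 + t)
      rwa [abs_of_nonneg h, abs_of_nonneg] at h2
      exact mul_nonneg (rpow_nonneg (abs_nonneg _) _) h
    have := abs_rpow_sub_one_le (q := p - 1) h (by linarith) (by linarith)
    rw [h1]
    have h5 : 1 + t - 1 = t := by ring
    rw [h5] at this
    linarith [abs_nonneg t]

theorem abs_oddPow_add_sub_le {p : ℝ} (hp1 : 1 < p) (hp2 : p < 2) {a : ℝ} (ha : a ≠ 0) (b : ℝ) :
    |oddPow p (a + b) - oddPow p a| ≤ 2 * |b| * |a| ^ (p - 2) := by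
  have h : oddPow p (a + b) - oddPow p a = oddPow p a * (oddPow p (1 + b / a) - 1) := by
    rw [mul_sub, ← oddPow_mul]
    field_simp
  have h0 : 0 < |a| := abs_pos.2 ha
  rw [h, abs_mul, abs_oddPow hp1]
  calc |a| ^ (p - 1) * |oddPow p (1 + b / a) - 1| ≤ |a| ^ (p - 1) * (2 * |b / a|) := by
        gcongr
        exact abs_oddPow_one_add_sub_one_le hp1 hp2 _
    _ = _ := by
        rw [show p - 1 = p - 2 + 1 by ring, rpow_add_one h0.ne', abs_div]
        field_simp

theorem enorm_oddPow_add_sub_le {p : ℝ} (hp1 : 1 < p) (hp2 : p < 2) {A B b : ℝ} (c : ℝ)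
    (hA : 0 < A) (hB : 0 < B) (hb : |b| ≤ B) :
    ‖oddPow p (A * c + b) - oddPow p (A * c)‖ₑ ≤
      ENNReal.ofReal (2 * B * A ^ (p - 2)) * ‖c‖ₑ ^ (p - 2) := by
  rcases eq_or_ne c 0 with rfl | hc
  · have : ENNReal.ofReal (2 * B * A ^ (p - 2)) ≠ 0 := by
      rw [ENNReal.ofReal_ne_zero_iff]
      positivity
    rw [enorm_zero, ENNReal.zero_rpow_of_neg (by linarith), ENNReal.mul_top this]
    exact le_top
  · rw [Real.enorm_eq_ofReal_abs, Real.enorm_eq_ofReal_abs,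
      ENNReal.ofReal_rpow_of_pos (abs_pos.2 hc), ← ENNReal.ofReal_mul (by positivity)]
    apply ENNReal.ofReal_le_ofReal
    have := abs_oddPow_add_sub_le hp1 hp2 (mul_ne_zero hA.ne' hc) b
    rw [abs_mul, abs_of_pos hA, mul_rpow hA.le (abs_nonneg c)] at this
    calc _ ≤ _ := this
      _ ≤ 2 * B * (A ^ (p - 2) * |c| ^ (p - 2)) := by gcongr
      _ = _ := by ring

theorem exists_abs_rpow_one_add_sub_le {γ : ℝ} (hγ : 1 ≤ γ) :
    ∃ C, 0 ≤ C ∧ ∀ t : ℝ, -3 / 4 ≤ t → t ≤ 5 / 4 →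
      |(1 + t) ^ γ - 1 - γ * t| ≤ C * t ^ 2 := by
  have hcont : ContinuousOn (fun u : ℝ => (γ - 1) * u ^ (γ - 1 - 1)) (Set.Icc (1 / 4) (9 / 4)) :=
    continuousOn_const.mul (continuousOn_id.rpow_const fun u hu => Or.inl (by
      have := hu.1; simp only [id]; linarith))
  obtain ⟨L, hL⟩ := isCompact_Icc.exists_bound_of_continuousOn hcont
  have hL0 : 0 ≤ L := (norm_nonneg _).trans (hL 1 ⟨by norm_num, by norm_num⟩)
  refine ⟨γ * L, by positivity, fun t ht1 ht2 => ?_⟩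
  have hpos : 0 < 1 + t := by linarith
  have hlip : |(1 + t) ^ (γ - 1) - 1| ≤ L * |t| := by
    have := (convex_Icc (1 / 4 : ℝ) (9 / 4)).norm_image_sub_le_of_norm_hasDerivWithin_le
      (f := fun u : ℝ => u ^ (γ - 1)) (x := 1) (y := 1 + t)
      (fun u hu => (hasDerivAt_rpow_const (Or.inl (by
        have := hu.1; linarith))).hasDerivWithinAt) hL
      ⟨by norm_num, by norm_num⟩ ⟨by linarith, by linarith⟩
    simpa using this
  have hlow : 1 + γ * t ≤ (1 + t) ^ γ := one_add_mul_self_le_rpow_one_add (by linarith) hγ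
  have hup : (1 + t) ^ γ - 1 ≤ γ * t * (1 + t) ^ (γ - 1) := by
    have h1 : -1 ≤ -t / (1 + t) := by rw [le_div_iff₀ hpos]; linarith
    have h2 := one_add_mul_self_le_rpow_one_add h1 hγ
    have h3 : 1 + -t / (1 + t) = (1 + t)⁻¹ := by field_simp; ring
    rw [h3, inv_rpow hpos.le] at h2
    have h4 : 0 < (1 + t) ^ γ := rpow_pos_of_pos hpos _
    have h5 := mul_le_mul_of_nonneg_right h2 h4.le
    rw [inv_mul_cancel₀ h4.ne'] at h5
    rw [rpow_sub_one hpos.ne']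
    have h6 : (1 + γ * (-t / (1 + t))) * (1 + t) ^ γ =
      (1 + t) ^ γ - γ * t * ((1 + t) ^ γ / (1 + t)) := by ring
    linarith
  rw [abs_of_nonneg (by linarith)]
  calc (1 + t) ^ γ - 1 - γ * t ≤ γ * (t * ((1 + t) ^ (γ - 1) - 1)) := by linarith
    _ ≤ γ * (|t| * (L * |t|)) := by
        refine mul_le_mul_of_nonneg_left ((le_abs_self _).trans ?_) (by linarith)
        rw [abs_mul]
        gcongr
    _ = γ * L * t ^ 2 := by rw [← sq_abs t]; ring

theorem exists_abs_norm_rpow_add_sub_le {E : Type*} [NormedAddCommGroup E] [InnerProductSpace ℝ E]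
    {β : ℝ} (hβ : 2 ≤ β) :
    ∃ C, 0 < C ∧ ∀ x y : E, 2 * ‖y‖ ≤ ‖x‖ → 0 < ‖x‖ →
      |‖x + y‖ ^ β - ‖x‖ ^ β - β * ‖x‖ ^ (β - 2) * inner ℝ x y| ≤
        C * ‖x‖ ^ (β - 2) * ‖y‖ ^ 2 := by
  obtain ⟨C, hC, h⟩ := exists_abs_rpow_one_add_sub_le (γ := β / 2) (by linarith)
  refine ⟨C * (25 / 4) + β / 2, by positivity, fun x y hxy hx => ?_⟩
  set t : ℝ := (2 * inner ℝ x y + ‖y‖ ^ 2) / ‖x‖ ^ 2 with ht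
  have hy := norm_nonneg y
  have hin := abs_le.1 (abs_real_inner_le_norm x y)
  have ht1 : ‖x + y‖ ^ 2 = ‖x‖ ^ 2 * (1 + t) := by
    rw [norm_add_sq_real, ht]; field_simp; ring
  have hnum : |2 * inner ℝ x y + ‖y‖ ^ 2| ≤ 5 / 2 * (‖x‖ * ‖y‖) := by
    rw [abs_le]; constructor <;> nlinarith
  have htu : t ≤ 5 / 4 := by
    rw [ht, div_le_iff₀ (by positivity)]
    nlinarith
  have htl : -3 / 4 ≤ t := by
    have h1 : ‖x‖ / 2 ≤ ‖x + y‖ := by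
      have := norm_sub_norm_le x (-y)
      rw [norm_neg, sub_neg_eq_add] at this
      linarith
    have h2 : (‖x‖ / 2) ^ 2 ≤ ‖x + y‖ ^ 2 := by gcongr
    rw [ht1] at h2
    have : 0 < ‖x‖ ^ 2 := by positivity
    nlinarith
  have ht2 : ‖x‖ ^ 2 * t ^ 2 ≤ 25 / 4 * ‖y‖ ^ 2 := by
    have h1 : ‖x‖ ^ 2 * t ^ 2 = |2 * inner ℝ x y + ‖y‖ ^ 2| ^ 2 / ‖x‖ ^ 2 := by
      rw [ht, sq_abs]; field_simp
    rw [h1, div_le_iff₀ (by positivity)]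
    calc _ ≤ (5 / 2 * (‖x‖ * ‖y‖)) ^ 2 := by gcongr
      _ = _ := by ring
  have hpow : ∀ z : E, ‖z‖ ^ β = (‖z‖ ^ 2) ^ (β / 2) := fun z => by
    rw [← rpow_natCast_mul (norm_nonneg z)]
    congr 1
    push_cast
    ring
  have hx2 : ‖x‖ ^ β = ‖x‖ ^ (β - 2) * ‖x‖ ^ 2 := by
    rw [← rpow_add_natCast hx.ne']; congr 1; push_cast; ring
  have hkey : ‖x + y‖ ^ β = ‖x‖ ^ β * (1 + t) ^ (β / 2) := by
    rw [hpow, hpow x, ht1, mul_rpow (by positivity) (by linarith)]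
  have hD : 0 < ‖x‖ ^ (β - 2) := rpow_pos_of_pos hx _
  have hid : ‖x + y‖ ^ β - ‖x‖ ^ β - β * ‖x‖ ^ (β - 2) * inner ℝ x y =
      ‖x‖ ^ (β - 2) * (‖x‖ ^ 2 * ((1 + t) ^ (β / 2) - 1 - β / 2 * t) + β / 2 * ‖y‖ ^ 2) := by
    have : ‖x‖ ^ 2 * t = 2 * inner ℝ x y + ‖y‖ ^ 2 := by rw [ht]; field_simp
    rw [hkey, hx2]
    linear_combination (-(β / 2) * ‖x‖ ^ (β - 2)) * (-this)
  rw [hid, abs_mul, abs_of_pos hD]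
  have h3 := h t htl htu
  calc _ ≤ ‖x‖ ^ (β - 2) * (‖x‖ ^ 2 * (C * t ^ 2) + β / 2 * ‖y‖ ^ 2) := by
        gcongr
        refine (abs_add_le _ _).trans ?_
        rw [abs_mul, abs_of_nonneg (sq_nonneg ‖x‖),
          abs_of_nonneg (by positivity : 0 ≤ β / 2 * ‖y‖ ^ 2)]
        gcongr
    _ ≤ ‖x‖ ^ (β - 2) * (C * (25 / 4 * ‖y‖ ^ 2) + β / 2 * ‖y‖ ^ 2) := by
        gcongr ?_ * (?_ + _)
        calc _ = C * (‖x‖ ^ 2 * t ^ 2) := by ring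
          _ ≤ _ := by gcongr
    _ = _ := by ring

theorem lintegral_enorm_rpow_Icc {q : ℝ} (hq : -1 < q) {R : ℝ} (hR : 0 < R) :
    ∫⁻ u in Set.Icc (-R) R, ‖u‖ₑ ^ q ≤ ENNReal.ofReal (2 / (q + 1) * R ^ (q + 1)) := by
  have hpos : ∫⁻ u in Set.Ioc 0 R, ‖u‖ₑ ^ q = ENNReal.ofReal (R ^ (q + 1) / (q + 1)) := by
    have h1 : ∫⁻ u in Set.Ioc 0 R, ‖u‖ₑ ^ q = ∫⁻ u in Set.Ioc 0 R, ENNReal.ofReal (u ^ q) := by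
      refine setLIntegral_congr_fun measurableSet_Ioc fun u hu => ?_
      rw [Real.enorm_of_nonneg hu.1.le, ENNReal.ofReal_rpow_of_pos hu.1]
    have h2 := (intervalIntegral.intervalIntegrable_rpow' (a := 0) (b := R) hq)
    rw [intervalIntegrable_iff_integrableOn_Ioc_of_le hR.le] at h2
    rw [h1, ← ofReal_integral_eq_lintegral_ofReal h2, ← intervalIntegral.integral_of_le hR.le,
      integral_rpow (Or.inl hq), zero_rpow (by linarith), sub_zero]
    filter_upwards [ae_restrict_mem measurableSet_Ioc] with u hu
    exact rpow_nonneg hu.1.le _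
  have hneg : ∫⁻ u in Set.Ico (-R) 0, ‖u‖ₑ ^ q = ∫⁻ u in Set.Ioc 0 R, ‖u‖ₑ ^ q := by
    have := (Measure.measurePreserving_neg (volume : Measure ℝ)).setLIntegral_comp_preimage_emb
      (MeasurableEquiv.neg ℝ).measurableEmbedding (fun u => ‖u‖ₑ ^ q) (Set.Ioc 0 R)
    rw [← this]
    simp
  have hsub : Set.Icc (-R) R ⊆ (Set.Ico (-R) 0 ∪ Set.Ioc 0 R) ∪ {0} := by
    intro u hu
    rcases lt_trichotomy u 0 with h | h | h
    · exact Or.inl (Or.inl ⟨hu.1, h⟩)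
    · exact Or.inr h
    · exact Or.inl (Or.inr ⟨h, hu.2⟩)
  calc _ ≤ ∫⁻ u in (Set.Ico (-R) 0 ∪ Set.Ioc 0 R) ∪ {0}, ‖u‖ₑ ^ q := lintegral_mono_set hsub
    _ ≤ (∫⁻ u in Set.Ico (-R) 0 ∪ Set.Ioc 0 R, ‖u‖ₑ ^ q) + ∫⁻ u in {0}, ‖u‖ₑ ^ q :=
        lintegral_union_le _ _ _
    _ = ∫⁻ u in Set.Ico (-R) 0 ∪ Set.Ioc 0 R, ‖u‖ₑ ^ q := by
        rw [setLIntegral_measure_zero {0} _ (by simp), add_zero]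
    _ ≤ (∫⁻ u in Set.Ico (-R) 0, ‖u‖ₑ ^ q) + ∫⁻ u in Set.Ioc 0 R, ‖u‖ₑ ^ q :=
        lintegral_union_le _ _ _
    _ = ENNReal.ofReal (2 / (q + 1) * R ^ (q + 1)) := by
        have : 0 < q + 1 := by linarith
        rw [hneg, hpos, ← ENNReal.ofReal_add (by positivity) (by positivity)]
        congr 1
        ring

/-- Averaging the translates of the ball in the direction `e` reduces this to one dimension. -/
theorem lintegral_ball_enorm_inner_rpow_le {E : Type*} [NormedAddCommGroup E]
    [InnerProductSpace ℝ E] [FiniteDimensional ℝ E] [MeasurableSpace E] [BorelSpace E]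
    (μ : Measure E) [μ.IsAddHaarMeasure] {q : ℝ} (hq : -1 < q) {e : E}
    (he : ‖e‖ = 1) {r : ℝ} (hr : 0 < r) :
    ∫⁻ y in ball (0 : E) r, ‖inner ℝ e y‖ₑ ^ q ∂μ ≤
      ENNReal.ofReal (2 ^ Module.finrank ℝ E * (2 / (q + 1) * 3 ^ (q + 1)) * r ^ q) *
        μ (ball (0 : E) r) := by
  set I := ∫⁻ y in ball (0 : E) r, ‖inner ℝ e y‖ₑ ^ q ∂μ with hI
  have hshift : ∀ s ∈ Set.Icc 0 r,
      I ≤ ∫⁻ y in ball (0 : E) (2 * r), ‖inner ℝ e y + s‖ₑ ^ q ∂μ := by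
    intro s hs
    rw [hI, ← (measurePreserving_add_right μ (s • e)).setLIntegral_comp_preimage_emb
      (MeasurableEquiv.addRight (s • e)).measurableEmbedding]
    have : ∀ y, inner ℝ e (y + s • e) = inner ℝ e y + s := fun y => by
      rw [inner_add_right, inner_smul_right, real_inner_self_eq_norm_sq, he]; ring
    simp only [this]
    refine lintegral_mono_set fun y hy => ?_
    simp only [Set.mem_preimage, mem_ball_zero_iff] at hy ⊢
    have h1 : ‖s • e‖ ≤ r := by
      rw [norm_smul, he, mul_one, Real.norm_of_nonneg hs.1]; exact hs.2
    have h2 := norm_sub_le (y + s • e) (s • e)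
    rw [add_sub_cancel_right] at h2
    linarith
  have hinner : ∀ y ∈ ball (0 : E) (2 * r), ∫⁻ s in Set.Icc 0 r, ‖inner ℝ e y + s‖ₑ ^ q ≤
      ENNReal.ofReal (2 / (q + 1) * (3 * r) ^ (q + 1)) := by
    intro y hy
    refine le_trans ?_ (lintegral_enorm_rpow_Icc hq (by positivity : 0 < 3 * r))
    rw [← (measurePreserving_add_left volume (inner ℝ e y : ℝ)).setLIntegral_comp_preimage_emb
      (MeasurableEquiv.addLeft _).measurableEmbedding (fun u : ℝ => ‖u‖ₑ ^ q)]
    refine lintegral_mono_set fun s hs => ?_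
    have h1 := abs_le.1 (abs_real_inner_le_norm e y)
    rw [he, one_mul] at h1
    rw [mem_ball_zero_iff] at hy
    simp only [Set.mem_preimage, Set.mem_Icc] at hs ⊢
    constructor <;> linarith [h1.1, h1.2, hs.1, hs.2]
  have hmain : I * ENNReal.ofReal r ≤
      ENNReal.ofReal (2 / (q + 1) * (3 * r) ^ (q + 1)) * μ (ball (0 : E) (2 * r)) := by
    calc I * ENNReal.ofReal r = ∫⁻ _ in Set.Icc (0 : ℝ) r, I := by simp
      _ ≤ ∫⁻ s in Set.Icc (0 : ℝ) r, ∫⁻ y in ball (0 : E) (2 * r), ‖inner ℝ e y + s‖ₑ ^ q ∂μ :=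
          setLIntegral_mono' measurableSet_Icc hshift
      _ = ∫⁻ y in ball (0 : E) (2 * r), ∫⁻ s in Set.Icc 0 r, ‖inner ℝ e y + s‖ₑ ^ q ∂volume ∂μ := by
          refine lintegral_lintegral_swap (Measurable.aemeasurable ?_)
          simp only [Function.uncurry_def]
          fun_prop
      _ ≤ ∫⁻ _ in ball (0 : E) (2 * r),
            ENNReal.ofReal (2 / (q + 1) * (3 * r) ^ (q + 1)) ∂μ :=
          setLIntegral_mono' measurableSet_ball hinner
      _ = _ := by simp
  have hq1 : 0 < q + 1 := by linarith
  rw [Measure.addHaar_ball_mul_of_pos μ 0 two_pos r, ← mul_assoc,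
    ← ENNReal.ofReal_mul (by positivity)] at hmain
  have hr0 : ENNReal.ofReal r ≠ 0 := by simpa using hr
  rw [← ENNReal.mul_le_mul_iff_left hr0 ENNReal.ofReal_ne_top]
  refine hmain.trans_eq ?_
  rw [mul_right_comm (ENNReal.ofReal _), ← ENNReal.ofReal_mul (by positivity)]
  congr 2
  rw [mul_rpow (by norm_num) hr.le, rpow_add_one hr.ne']
  ring

theorem integrableOn_ball_oddPow {E : Type*} [NormedAddCommGroup E] [ProperSpace E]
    [MeasurableSpace E] [BorelSpace E] (μ : Measure E) [IsFiniteMeasureOnCompacts μ]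
    {p : ℝ} (hp : 1 < p) {g : E → ℝ} (hg : Continuous g) (x : E) (r : ℝ) :
    IntegrableOn (fun y => oddPow p (g y)) (ball x r) μ := by
  obtain ⟨M, hM⟩ := (isCompact_closedBall x r).exists_bound_of_continuousOn hg.continuousOn
  refine Measure.integrableOn_of_bounded (M := M ^ (p - 1)) measure_ball_lt_top.ne
    ((measurable_oddPow p).comp hg.measurable).aestronglyMeasurable ?_
  filter_upwards [ae_restrict_mem measurableSet_ball] with y hy
  rw [Real.norm_eq_abs, abs_oddPow hp]
  exact rpow_le_rpow (abs_nonneg _) (hM y (ball_subset_closedBall hy)) (by linarith)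

theorem setIntegral_ball_oddPow_inner {E : Type*} [NormedAddCommGroup E]
    [InnerProductSpace ℝ E] [MeasurableSpace E] [BorelSpace E] (μ : Measure E) [μ.IsNegInvariant]
    (p A : ℝ) (e : E) (r : ℝ) :
    ∫ y in ball (0 : E) r, oddPow p (A * inner ℝ e y) ∂μ = 0 := by
  have h := (Measure.measurePreserving_neg μ).setIntegral_preimage_emb
    (MeasurableEquiv.neg E).measurableEmbedding (fun y => oddPow p (A * inner ℝ e y)) (ball 0 r)
  have hpre : Neg.neg ⁻¹' ball (0 : E) r = ball 0 r := by
    ext y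
    simp
  simp only [hpre, inner_neg_right, mul_neg, oddPow_neg, integral_neg] at h
  linarith

theorem exists_setIntegral_oddPow_le_of_two_mul_le {E : Type*} [NormedAddCommGroup E]
    [InnerProductSpace ℝ E] [FiniteDimensional ℝ E] [MeasurableSpace E] [BorelSpace E]
    (μ : Measure E) [μ.IsAddHaarMeasure] {p β : ℝ} (hp1 : 1 < p) (hp2 : p < 2) (hβ : 2 ≤ β) :
    ∃ C, 0 ≤ C ∧ ∀ r : ℝ, 0 < r → ∀ x : E, 2 * r ≤ ‖x‖ →
      |∫ y in ball (0 : E) r, oddPow p (‖x + y‖ ^ β - ‖x‖ ^ β) ∂μ| ≤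
        C * ‖x‖ ^ ((β - 1) * (p - 1) - 1) * r ^ p * μ.real (ball (0 : E) r) := by
  obtain ⟨C, hC, hT⟩ := exists_abs_norm_rpow_add_sub_le (E := E) hβ
  set K : ℝ := 2 ^ Module.finrank ℝ E * (2 / (p - 2 + 1) * 3 ^ (p - 2 + 1)) with hK
  have hK0 : 0 ≤ K := by
    have : 0 < p - 2 + 1 := by linarith
    positivity
  refine ⟨2 * C * β ^ (p - 2) * K, by positivity, fun r hr x hx => ?_⟩
  have hx0 : 0 < ‖x‖ := by linarith
  set e : E := ‖x‖⁻¹ • x with he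
  have he1 : ‖e‖ = 1 := by
    rw [he, norm_smul, norm_inv, norm_norm, inv_mul_cancel₀ hx0.ne']
  set A : ℝ := β * ‖x‖ ^ (β - 1) with hA
  have hA0 : 0 < A := by positivity
  set B : ℝ := C * ‖x‖ ^ (β - 2) * r ^ 2 with hB
  have hB0 : 0 < B := by positivity
  set F : E → ℝ := fun y => ‖x + y‖ ^ β - ‖x‖ ^ β with hF
  have hFc : Continuous F := by
    have : Continuous fun y => ‖x + y‖ ^ β :=
      (continuous_const.add continuous_id).norm.rpow_const fun _ => Or.inr (by linarith)
    exact this.sub continuous_const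
  have hlin : ∀ y, A * inner ℝ e y = β * ‖x‖ ^ (β - 2) * inner ℝ x y := fun y => by
    rw [hA, he, real_inner_smul_left, show β - 1 = β - 2 + 1 by ring, rpow_add_one hx0.ne']
    field_simp
  have hsub : ∫ y in ball (0 : E) r, oddPow p (F y) ∂μ =
      ∫ y in ball (0 : E) r, (oddPow p (F y) - oddPow p (A * inner ℝ e y)) ∂μ := by
    rw [integral_sub (integrableOn_ball_oddPow μ hp1 hFc 0 r)
      (integrableOn_ball_oddPow μ hp1 (by fun_prop) 0 r),
      setIntegral_ball_oddPow_inner, sub_zero]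
  have hpt : ∀ y ∈ ball (0 : E) r, ‖oddPow p (F y) - oddPow p (A * inner ℝ e y)‖ₑ ≤
      ENNReal.ofReal (2 * B * A ^ (p - 2)) * ‖inner ℝ e y‖ₑ ^ (p - 2) := by
    intro y hy
    rw [mem_ball_zero_iff] at hy
    have hb : |F y - A * inner ℝ e y| ≤ B := by
      rw [hlin]
      refine (hT x y (by linarith) hx0).trans ?_
      rw [hB]
      gcongr
    have := enorm_oddPow_add_sub_le hp1 hp2 (inner ℝ e y) hA0 hB0 hb
    rwa [add_sub_cancel] at this
  have hbound : ‖∫ y in ball (0 : E) r, oddPow p (F y) ∂μ‖ₑ ≤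
      ENNReal.ofReal (2 * B * A ^ (p - 2) * (K * r ^ (p - 2)) * μ.real (ball (0 : E) r)) := by
    rw [hsub]
    calc _ ≤ ∫⁻ y in ball (0 : E) r, ‖oddPow p (F y) - oddPow p (A * inner ℝ e y)‖ₑ ∂μ :=
          enorm_integral_le_lintegral_enorm _
      _ ≤ ∫⁻ y in ball (0 : E) r,
            ENNReal.ofReal (2 * B * A ^ (p - 2)) * ‖inner ℝ e y‖ₑ ^ (p - 2) ∂μ :=
          setLIntegral_mono' measurableSet_ball hpt
      _ = ENNReal.ofReal (2 * B * A ^ (p - 2)) *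
            ∫⁻ y in ball (0 : E) r, ‖inner ℝ e y‖ₑ ^ (p - 2) ∂μ :=
          lintegral_const_mul' _ _ ENNReal.ofReal_ne_top
      _ ≤ ENNReal.ofReal (2 * B * A ^ (p - 2)) *
            (ENNReal.ofReal (K * r ^ (p - 2)) * μ (ball (0 : E) r)) := by
          gcongr
          exact lintegral_ball_enorm_inner_rpow_le μ (by linarith) he1 hr
      _ = _ := by
          rw [← ofReal_measureReal measure_ball_lt_top.ne, ← mul_assoc,
            ← ENNReal.ofReal_mul (by positivity), ← ENNReal.ofReal_mul (by positivity)]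
  rw [Real.enorm_eq_ofReal_abs, ENNReal.ofReal_le_ofReal_iff (by positivity)] at hbound
  refine hbound.trans_eq ?_
  have h1 : r ^ p = r ^ (p - 2) * r ^ 2 := by
    rw [← rpow_add_natCast hr.ne']; congr 1; push_cast; ring
  have h2 : ‖x‖ ^ ((β - 1) * (p - 1) - 1) = ‖x‖ ^ (β - 2) * ‖x‖ ^ ((β - 1) * (p - 2)) := by
    rw [← rpow_add hx0]; congr 1; ring
  rw [hA, hB, mul_rpow (by linarith) (by positivity), ← rpow_mul hx0.le, h1, h2]
  ring

theorem setIntegral_oddPow_le_of_le_two_mul {E : Type*} [NormedAddCommGroup E]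
    [NormedSpace ℝ E] [FiniteDimensional ℝ E] [MeasurableSpace E] [BorelSpace E]
    (μ : Measure E) [IsFiniteMeasureOnCompacts μ] {p β : ℝ} (hp1 : 1 < p) (hβ : 0 ≤ β)
    {r : ℝ} {x : E} (hr : 0 < r) (hx : ‖x‖ ≤ 2 * r) :
    |∫ y in ball (0 : E) r, oddPow p (‖x + y‖ ^ β - ‖x‖ ^ β) ∂μ| ≤
      3 ^ (β * (p - 1)) * r ^ (β * (p - 1) - p) * r ^ p * μ.real (ball (0 : E) r) := by
  have := FiniteDimensional.proper ℝ E
  have h : ∀ y ∈ ball (0 : E) r,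
      ‖oddPow p (‖x + y‖ ^ β - ‖x‖ ^ β)‖ ≤ (3 * r) ^ (β * (p - 1)) := by
    intro y hy
    rw [mem_ball_zero_iff] at hy
    rw [Real.norm_eq_abs, abs_oddPow hp1, rpow_mul (by positivity)]
    refine rpow_le_rpow (abs_nonneg _) ?_ (by linarith)
    refine abs_sub_le_of_nonneg_of_le (by positivity) ?_ (by positivity) ?_
    · gcongr
      linarith [norm_add_le x y]
    · gcongr
      linarith
  refine (norm_setIntegral_le_of_norm_le_const measure_ball_lt_top h).trans_eq ?_
  rw [mul_rpow (by norm_num) hr.le, mul_assoc (3 ^ _ : ℝ) _ (r ^ p), ← rpow_add hr,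
    sub_add_cancel]

theorem exists_pos_forall_mul_rpow_lt {κ ε : ℝ} (hκ : 0 < κ) (hε : 0 < ε) (C : ℝ) :
    ∃ δ > 0, ∀ t : ℝ, 0 ≤ t → t < δ → C * t ^ κ < ε := by
  have hc : ContinuousAt (fun t : ℝ => C * t ^ κ) 0 :=
    continuousAt_const.mul (continuousAt_rpow_const 0 κ (Or.inr hκ.le))
  have h := hc.eventually_lt_const (u := ε) (by simpa [zero_rpow hκ.ne'] using hε)
  obtain ⟨δ, hδ, h⟩ := Metric.eventually_nhds_iff.1 h
  exact ⟨δ, hδ, fun t ht0 ht => h (by rwa [Real.dist_0_eq_abs, abs_of_nonneg ht0])⟩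

theorem stmt_18 (d : ℕ) (p β : ℝ) (hp1 : 1 < p) (hp2 : p < 2) (hβ : p / (p - 1) < β) :
    ∀ ε > 0, ∃ δ > 0, ∀ r : ℝ, 0 < r → r < δ →
      ∀ x : EuclideanSpace ℝ (Fin d), ‖x‖ < δ →
        |(1 / r ^ p) * ⨍ y in ball (0 : EuclideanSpace ℝ (Fin d)) r,
            |‖x + y‖ ^ β - ‖x‖ ^ β| ^ (p - 2) * (‖x + y‖ ^ β - ‖x‖ ^ β)| < ε := by
  intro ε hε
  have hp : 0 < p - 1 := by linarith
  have hβp : p < β * (p - 1) := (div_lt_iff₀ hp).1 hβ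
  have hβ2 : 2 ≤ β := by nlinarith
  obtain ⟨C, hC, hfar⟩ := exists_setIntegral_oddPow_le_of_two_mul_le
    (volume : Measure (EuclideanSpace ℝ (Fin d))) hp1 hp2 hβ2
  obtain ⟨δ₁, hδ₁, h₁⟩ := exists_pos_forall_mul_rpow_lt
    (show 0 < (β - 1) * (p - 1) - 1 by linarith) hε C
  obtain ⟨δ₂, hδ₂, h₂⟩ := exists_pos_forall_mul_rpow_lt
    (show 0 < β * (p - 1) - p by linarith) hε (3 ^ (β * (p - 1)))
  refine ⟨min δ₁ δ₂, lt_min hδ₁ hδ₂, fun r hr hrδ x hx => ?_⟩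
  have hvol : 0 < volume.real (ball (0 : EuclideanSpace ℝ (Fin d)) r) :=
    ENNReal.toReal_pos (measure_ball_pos _ _ hr).ne' measure_ball_lt_top.ne
  have hrp : 0 < r ^ p := rpow_pos_of_pos hr p
  suffices h : |∫ y in ball (0 : EuclideanSpace ℝ (Fin d)) r,
      oddPow p (‖x + y‖ ^ β - ‖x‖ ^ β)| <
        ε * r ^ p * volume.real (ball (0 : EuclideanSpace ℝ (Fin d)) r) by
    rw [setAverage_eq, smul_eq_mul, abs_mul, abs_mul, abs_of_pos (one_div_pos.2 hrp),
      abs_of_pos (inv_pos.2 hvol), one_div, inv_mul_lt_iff₀ hrp, inv_mul_lt_iff₀ hvol]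
    refine h.trans_eq ?_
    ring
  rcases le_total (2 * r) ‖x‖ with hxr | hxr
  · refine (hfar r hr x hxr).trans_lt ?_
    gcongr
    exact h₁ _ (norm_nonneg x) (hx.trans_le (min_le_left _ _))
  · refine (setIntegral_oddPow_le_of_le_two_mul volume hp1 (by linarith) hr hxr).trans_lt ?_
    gcongr
    exact h₂ _ hr.le (hrδ.trans_le (min_le_right _ _))
end
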